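/- arXiv:alg-geom/9609003 — 11 statements merged into one kernel-verified Lean document; each statement's English description precedes it below -/
import Mathlib

section
/- Fix integers n ≥ 1 and 0 ≤ i < n. Let f be a non-constant square-free polynomial in ℚ[X₁,…,Xₙ] whose real zero set Ṽ(f) = {x ∈ ℝⁿ : f(x) = 0} is bounded. For a real matrix a = (a_{jk}) with i+1 ≤ j ≤ n, 1 ≤ k ≤ i, let A⁽ⁱ⁾ be the n×n block matrix with identity blocks I_{i,i} and I_{n−i,n−i} on the diagonal, the block (a_{jk}) in the lower-left corner and zero block in the upper-right corner, and set h_a = f ∘ A⁽ⁱ⁾ (the polynomial f after the linear change of coordinates x ← A⁽ⁱ⁾y). Then there exists an open and dense subset O of the space ℝ^{(n−i)×i} of such matrices with the following property: for every a ∈ O and every point y ∈ ℝⁿ satisfying h_a(y) = ∂h_a/∂Y₁(y) = ⋯ = ∂h_a/∂Y_i(y) = 0, if the gradient of h_a at y is nonzero, then the Jacobian matrix at y of the system (h_a, ∂h_a/∂Y₁, …, ∂h_a/∂Y_i) has maximal rank i+1. -/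
open MvPolynomial

/-- The block matrix `A⁽ⁱ⁾` with identity blocks `I_{i,i}` and `I_{n-i,n-i}` on the
diagonal, the block `a = (a_{jk})_{i+1 ≤ j ≤ n, 1 ≤ k ≤ i}` in the lower-left corner
and the zero block in the upper-right corner. -/
noncomputable def blockMatrix (n i : ℕ) (hi : i < n) (a : Fin (n - i) → Fin i → ℝ) :
    Matrix (Fin n) (Fin n) ℝ :=
  Matrix.of fun j k =>
    if (j : ℕ) = (k : ℕ) then 1
    else if h : i ≤ (j : ℕ) ∧ (k : ℕ) < i then
      a ⟨(j : ℕ) - i, by have := j.isLt; omega⟩ ⟨(k : ℕ), h.2⟩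
    else 0

/-- The polynomial `h_a = f ∘ A⁽ⁱ⁾`, i.e. `f` after the linear change of coordinates
`x ← A⁽ⁱ⁾ y`. -/
noncomputable def transformedPoly (n i : ℕ) (hi : i < n) (f : MvPolynomial (Fin n) ℚ)
    (a : Fin (n - i) → Fin i → ℝ) : MvPolynomial (Fin n) ℝ :=
  aeval (fun m : Fin n => ∑ k : Fin n, C (blockMatrix n i hi a m k) * X k) f

open scoped TensorProduct

theorem exists_deriv_of_basis {K ι : Type} [Field K] [CharZero K] [Algebra ℚ K] (b : ι → K)
    (hb : IsTranscendenceBasis ℚ b) (c : ι → K) : ∃ D : Derivation ℚ K K, ∀ i, D (b i) = c i := by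
  let S := MvPolynomial ι ℚ
  let _ : Algebra S K := (aeval b : S →ₐ[ℚ] K).toRingHom.toAlgebra
  have : IsScalarTower ℚ S K := .of_algebraMap_eq' (by ext; simp)
  have hmap : ∀ p : S, algebraMap S K p = aeval b p := fun p => rfl
  have hinj : Function.Injective (algebraMap S K) := hb.1
  have : FaithfulSMul S K := (faithfulSMul_iff_algebraMap_injective S K).2 hinj
  have : Algebra.IsAlgebraic S K := by
    have := hb.isAlgebraic
    constructor
    intro z
    have hz := this.isAlgebraic z
    refine (isAlgebraic_ringHom_iff_of_comp_eq (hb.1.aevalEquiv : S ≃ₐ[ℚ] _) (RingHom.id K) Function.injective_id ?_ ).1 hz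
    ext j
    · simp
    · simp; exact (aeval_X b j).symm
  let F := FractionRing S
  let _ : Algebra F K := FractionRing.liftAlgebra S K
  have : IsScalarTower S F K := inferInstance
  have : Algebra.IsAlgebraic F K := (IsFractionRing.comap_isAlgebraic_iff (A := S) (K := F) (C := K)).1 inferInstance
  have : CharZero F := charZero_of_injective_algebraMap (IsFractionRing.injective S F)
  have : Algebra.FormallyEtale F K := Algebra.FormallyEtale.of_isSeparable F K
  have : Algebra.FormallyEtale S F := .of_isLocalization (nonZeroDivisors S)
  have : Algebra.FormallyEtale S K := .comp S F K
  let d : Derivation ℚ S K := mkDerivation ℚ c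
  let L : Ω[K⁄ℚ] →ₗ[K] K := (d.liftKaehlerDifferential.liftBaseChange K) ∘ₗ
    (KaehlerDifferential.tensorKaehlerEquivOfFormallyEtale ℚ S K).symm.toLinearMap
  refine ⟨L.compDer (KaehlerDifferential.D ℚ K), fun i => ?_⟩
  have : b i = algebraMap S K (X i) := by simp [hmap]
  simp only [this, L]
  simp [KaehlerDifferential.tensorKaehlerEquivOfFormallyEtale_symm_D_algebraMap, d]
  exact mkDerivation_X _ _ _

theorem exists_deriv {K ι : Type} [Field K] [CharZero K] [Algebra ℚ K] (a : ι → K)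
    (ha : AlgebraicIndependent ℚ a) (c : ι → K) : ∃ D : Derivation ℚ K K, ∀ i, D (a i) = c i := by
  classical
  obtain ⟨t, hst, ht⟩ := exists_isTranscendenceBasis_superset (show AlgebraicIndepOn ℚ id (Set.range a) from ha.coe_range)
  have hinj := ha.injective
  obtain ⟨D, hD⟩ := exists_deriv_of_basis _ ht (fun x => Function.extend a c 0 x.1)
  refine ⟨D, fun i => ?_⟩
  have := hD ⟨a i, hst ⟨i, rfl⟩⟩
  simpa [hinj.extend_apply] using this

theorem deriv_aeval {K σ : Type} [Fintype σ] [Field K] [Algebra ℚ K] (D : Derivation ℚ K K)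
    (x : σ → K) (f : MvPolynomial σ ℚ) :
    D (aeval x f) = ∑ p, aeval x (pderiv p f) * D (x p) := by
  classical
  induction f using MvPolynomial.induction_on with
  | C r => rw [aeval_C, D.map_algebraMap]; simp
  | add p q hp hq => simp [hp, hq, add_mul, Finset.sum_add_distrib]
  | mul_X p j hp =>
    simp [hp, pderiv_X, add_mul, Finset.sum_add_distrib, Finset.mul_sum, Pi.single_apply, mul_assoc, apply_ite]

/-- key algebraic lemma -/
theorem key {K : Type} [Field K] [CharZero K] [Algebra ℚ K] {n i : ℕ}
    (u : Fin i → Fin n) (w : Fin (n - i) → Fin n)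
    (a : Fin (n - i) → Fin i → K)
    (ha : AlgebraicIndependent ℚ (fun s : Fin (n - i) × Fin i => a s.1 s.2))
    (f : MvPolynomial (Fin n) ℚ) (x : Fin n → K) (l0 : K) (l : Fin i → K)
    (h0 : aeval x f = 0)
    (h1 : ∀ k, aeval x (pderiv (u k) f) + ∑ j, a j k * aeval x (pderiv (w j) f) = 0)
    (j0 : Fin (n - i)) (hj : aeval x (pderiv (w j0) f) ≠ 0)
    (hl : ∀ p, l0 * aeval x (pderiv p f) + ∑ k, l k * (aeval x (pderiv p (pderiv (u k) f)) +
      ∑ j, a j k * aeval x (pderiv p (pderiv (w j) f))) = 0) :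
    l0 = 0 ∧ ∀ k, l k = 0 := by
  classical
  have hlk : ∀ k, l k = 0 := by
    intro k0
    obtain ⟨D, hD⟩ := exists_deriv _ ha (Pi.single (j0, k0) 1)
    have hD' : ∀ j k, D (a j k) = if j = j0 ∧ k = k0 then 1 else 0 := by
      intro j k
      have := hD (j, k)
      simpa [Pi.single_apply] using this
    have e0 := congrArg D h0
    rw [deriv_aeval, map_zero] at e0
    have e1 : ∀ k, (∑ p, (aeval x (pderiv p (pderiv (u k) f)) +
      ∑ j, a j k * aeval x (pderiv p (pderiv (w j) f))) * D (x p)) +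
        (if k = k0 then aeval x (pderiv (w j0) f) else 0) = 0 := by
      intro k
      have := congrArg D (h1 k)
      simp only [map_add, map_sum, Derivation.leibniz, deriv_aeval, map_zero, smul_eq_mul, hD'] at this
      refine Eq.trans ?_ this
      simp only [add_mul, Finset.sum_add_distrib, add_assoc, Finset.sum_mul, Finset.mul_sum]
      congr 1
      rw [Finset.sum_comm]
      congr 1
      · simp [mul_assoc]
      · by_cases hk : k = k0 <;> simp [hk]
    have e2 : ∑ p, (l0 * aeval x (pderiv p f) + ∑ k, l k * (aeval x (pderiv p (pderiv (u k) f)) +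
      ∑ j, a j k * aeval x (pderiv p (pderiv (w j) f)))) * D (x p) = 0 := by
      simp [hl]
    have e3 : ∑ k, l k * ((∑ p, (aeval x (pderiv p (pderiv (u k) f)) +
      ∑ j, a j k * aeval x (pderiv p (pderiv (w j) f))) * D (x p)) +
        (if k = k0 then aeval x (pderiv (w j0) f) else 0)) = 0 := by simp [e1]
    simp only [add_mul _ _ (D _), Finset.sum_add_distrib, Finset.sum_mul, mul_assoc, ← Finset.mul_sum, e0] at e2
    rw [Finset.sum_comm] at e2
    simp only [mul_assoc, ← Finset.mul_sum] at e2
    simp only [mul_add (l _) _ (ite _ _ _), Finset.sum_add_distrib] at e3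
    simp only [add_mul _ _ (D _), Finset.sum_add_distrib, Finset.sum_mul, mul_assoc] at e3 e2
    simp only [mul_zero, zero_add] at e2
    rw [e2] at e3
    simpa [hj] using e3
  refine ⟨?_, hlk⟩
  have := hl (w j0)
  simpa [hlk, hj] using this

/-- bad parameters -/
def BadPar {n i : ℕ} (u : Fin i → Fin n) (w : Fin (n - i) → Fin n)
    (f : MvPolynomial (Fin n) ℚ) (a : Fin (n - i) → Fin i → ℝ) : Prop :=
  ∃ (x : Fin n → ℝ) (l0 : ℝ) (l : Fin i → ℝ), aeval x f = 0 ∧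
    (∀ k, aeval x (pderiv (u k) f) + ∑ j, a j k * aeval x (pderiv (w j) f) = 0) ∧
    (∃ j, aeval x (pderiv (w j) f) ≠ 0) ∧
    (∀ p, l0 * aeval x (pderiv p f) + ∑ k, l k * (aeval x (pderiv p (pderiv (u k) f)) +
      ∑ j, a j k * aeval x (pderiv p (pderiv (w j) f))) = 0) ∧
    ¬ (l0 = 0 ∧ ∀ k, l k = 0)

theorem bad_poly {n i : ℕ} (u : Fin i → Fin n) (w : Fin (n - i) → Fin n)
    (f : MvPolynomial (Fin n) ℚ) :
    ∃ P : MvPolynomial (Fin (n - i) × Fin i) ℚ, P ≠ 0 ∧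
      ∀ a : Fin (n - i) → Fin i → ℝ, BadPar u w f a →
        aeval (fun s : Fin (n - i) × Fin i => a s.1 s.2) P = 0 := by
  classical
  by_contra! hcon
  let B := {a : Fin (n - i) → Fin i → ℝ // BadPar u w f a}
  let T := {P : MvPolynomial (Fin (n - i) × Fin i) ℚ // P ≠ 0}
  let ev : B → MvPolynomial (Fin (n - i) × Fin i) ℚ → ℝ :=
    fun b P => aeval (fun s : Fin (n - i) × Fin i => b.1 s.1 s.2) P
  let F : Filter B := ⨅ P : T, Filter.principal {b | ev b P.1 ≠ 0}
  have : Nonempty T := ⟨⟨1, one_ne_zero⟩⟩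
  have hF : F.NeBot := by
    apply Filter.iInf_neBot_of_directed'
    · intro P Q
      refine ⟨⟨P.1 * Q.1, mul_ne_zero P.2 Q.2⟩, ?_, ?_⟩
      · simp only [ge_iff_le, Filter.le_principal_iff, Filter.mem_principal]
        intro b hb
        simp only [Set.mem_ofPred_eq, ev, map_mul] at hb ⊢
        exact left_ne_zero_of_mul hb
      · simp only [ge_iff_le, Filter.le_principal_iff, Filter.mem_principal]
        intro b hb
        simp only [Set.mem_ofPred_eq, ev, map_mul] at hb ⊢
        exact right_ne_zero_of_mul hb
    · intro P
      obtain ⟨a, ha, hP⟩ := hcon P.1 P.2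
      exact Filter.principal_neBot_iff.2 ⟨⟨a, ha⟩, hP⟩
  let U : Ultrafilter B := Ultrafilter.of F
  have hU : ∀ P, P ≠ 0 → ∀ᶠ b in (U : Filter B), ev b P ≠ 0 := by
    intro P hP
    exact (Ultrafilter.of_le F) (Filter.mem_iInf_of_mem (⟨P, hP⟩ : T) (Filter.mem_principal_self _))
  let K := Filter.Germ (U : Filter B) ℝ
  let φ : (B → ℝ) →+* K := Filter.Germ.coeRingHom (U : Filter B)
  have hφ : ∀ g : B → ℝ, φ g = 0 ↔ ∀ᶠ b in (U : Filter B), g b = 0 := by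
    intro g
    exact Filter.Germ.coe_eq
  have : CharZero K := charZero_of_injective_ringHom
    (f := φ.comp (Pi.constRingHom B ℝ)) (RingHom.injective _)
  let φ' : (B → ℝ) →ₐ[ℚ] K := φ.toRatAlgHom
  have hae : ∀ {σ : Type} (y : B → σ → ℝ) (P : MvPolynomial σ ℚ),
      aeval (fun p => φ (fun b => y b p)) P = φ (fun b => aeval (y b) P) := by
    intro σ y P
    have h1 : aeval (fun p => φ (fun b => y b p)) P = φ' (aeval (fun p b => y b p) P) :=
      (comp_aeval_apply (fun p b => y b p) φ' P).symm
    rw [h1]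
    change φ _ = _
    congr 1
    funext b
    exact (comp_aeval_apply (fun p b => y b p) (Pi.evalAlgHom ℚ (fun _ : B => ℝ) b) P)
  choose x l0 l h0 h1 h2 h3 h4 using fun b : B => b.2
  have hj : ∃ j0, aeval (fun p => φ (fun b => x b p)) (pderiv (w j0) f) ≠ 0 := by
    by_contra! hno
    simp only [hae, hφ] at hno
    obtain ⟨b, hb⟩ := (Filter.eventually_all.2 hno).exists
    obtain ⟨j, hj⟩ := h2 b
    exact hj (hb j)
  obtain ⟨j0, hj0⟩ := hj
  have fin := key u w (fun j k => φ (fun b => b.1 j k)) ?_ f (fun p => φ (fun b => x b p))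
    (φ l0) (fun k => φ (fun b => l b k)) ?_ ?_ j0 hj0 ?_
  · simp only [hφ] at fin
    obtain ⟨b, hb, hb'⟩ := (fin.1.and (Filter.eventually_all.2 fin.2)).exists
    exact h4 b ⟨hb, hb'⟩
  · rw [algebraicIndependent_iff]
    intro P hP
    by_contra hP0
    rw [hae (fun (b : B) (s : Fin (n - i) × Fin i) => b.1 s.1 s.2), hφ] at hP
    obtain ⟨b, hb, hb'⟩ := (hP.and (hU P hP0)).exists
    exact hb' hb
  · rw [hae, hφ]
    exact Filter.Eventually.of_forall h0
  · intro k
    simp only [hae, ← map_mul, ← map_sum, ← map_add]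
    rw [hφ]
    refine Filter.Eventually.of_forall fun b => ?_
    simpa using h1 b k
  · intro k
    simp only [hae, ← map_mul, ← map_sum, ← map_add]
    rw [hφ]
    refine Filter.Eventually.of_forall fun b => ?_
    simpa using h3 b k

theorem dense_ne {σ : Type} [Finite σ] (P : MvPolynomial σ ℝ) (hP : P ≠ 0) :
    Dense {x : σ → ℝ | eval x P ≠ 0} := by
  have := Fintype.ofFinite σ
  rw [← compl_compl {x : σ → ℝ | eval x P ≠ 0}, ← interior_eq_empty_iff_dense_compl,
    Set.eq_empty_iff_forall_notMem]
  intro x hx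
  obtain ⟨ε, hε, hb⟩ := Metric.isOpen_iff.1 isOpen_interior x hx
  apply hP
  refine funext_set (fun s => Metric.ball (x s) ε) (fun s => ?_) (fun y hy => ?_)
  · rw [Real.ball_eq_Ioo]; exact Set.Ioo_infinite (by linarith)
  · rw [ball_pi x hε] at hb
    have := interior_subset (hb hy)
    simpa using this

theorem pderiv_transformed (n i : ℕ) (hi : i < n) (f : MvPolynomial (Fin n) ℚ)
    (a : Fin (n - i) → Fin i → ℝ) (m : Fin n) :
    pderiv m (transformedPoly n i hi f a) =
      ∑ l, C (blockMatrix n i hi a l m) * transformedPoly n i hi (pderiv l f) a := by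
  classical
  unfold transformedPoly
  induction f using MvPolynomial.induction_on with
  | C r => rw [aeval_C]; simp [MvPolynomial.algebraMap_apply]
  | add p q hp hq => simp [hp, hq, mul_add, Finset.sum_add_distrib]
  | mul_X p j hp =>
    have hL : pderiv m (∑ k : Fin n, C (blockMatrix n i hi a j k) * X k :
        MvPolynomial (Fin n) ℝ) = C (blockMatrix n i hi a j m) := by
      rw [map_sum, Finset.sum_eq_single m]
      · rw [pderiv_C_mul, pderiv_X_self, mul_one]
      · intro b _ hb
        rw [pderiv_C_mul, pderiv_X_of_ne hb, mul_zero]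
      · simp
    have hR : ∀ l, aeval (fun m : Fin n => ∑ k : Fin n, C (blockMatrix n i hi a m k) * X k)
        (pderiv l (X j : MvPolynomial (Fin n) ℚ)) = if l = j then (1 : MvPolynomial (Fin n) ℝ) else 0 := by
      intro l
      by_cases h : l = j
      · subst h; simp
      · rw [pderiv_X_of_ne (fun h' => h h'.symm)]; simp [h]
    rw [map_mul, Derivation.leibniz, aeval_X, hL, hp]
    simp only [Derivation.leibniz, map_add, smul_eq_mul, map_mul, hR, aeval_X, mul_add,
      Finset.sum_add_distrib]
    congr 1
    · rw [Finset.sum_eq_single j]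
      · rw [if_pos rfl]; ring
      · intro b _ hb
        rw [if_neg hb]; ring
      · simp
    · rw [Finset.mul_sum]
      exact Finset.sum_congr rfl fun _ _ => by ring

theorem swap_sum {ι κ : Type} [Fintype ι] [Fintype κ] (A : ι → ℝ) (c : κ → ℝ) (G : ι → κ → ℝ) :
    ∑ p, A p * ∑ k, c k * G p k = ∑ k, c k * ∑ p, A p * G p k := by
  simp only [Finset.mul_sum]
  rw [Finset.sum_comm]
  exact Finset.sum_congr rfl fun _ _ => Finset.sum_congr rfl fun _ _ => by ring

theorem col_ge (n i : ℕ) (hi : i < n) (a : Fin (n - i) → Fin i → ℝ) (m : Fin n) (hm : i ≤ (m : ℕ))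
    (v : Fin n → ℝ) : ∑ l, blockMatrix n i hi a l m * v l = v m := by
  rw [Finset.sum_eq_single m]
  · simp [blockMatrix]
  · intro b _ hb
    have : (b : ℕ) ≠ m := fun h => hb (Fin.ext h)
    simp [blockMatrix, this, not_lt.2 hm]
  · simp

theorem col_lt (n i : ℕ) (hi : i < n) (a : Fin (n - i) → Fin i → ℝ) (k : Fin i)
    (v : Fin n → ℝ) : ∑ l, blockMatrix n i hi a l (Fin.castLE hi.le k) * v l =
      v (Fin.castLE hi.le k) +
        ∑ j : Fin (n - i), a j k * v ⟨i + j, by omega⟩ := by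
  let e : Fin (i + (n - i)) ≃ Fin n := finCongr (by omega)
  rw [← e.sum_comp, Fin.sum_univ_add]
  congr 1
  · rw [Finset.sum_eq_single k]
    · have : e (Fin.castAdd (n - i) k) = Fin.castLE hi.le k := by ext; simp [e]
      rw [this]; simp [blockMatrix]
    · intro b _ hb
      have : (b : ℕ) ≠ k := fun h => hb (Fin.ext h)
      have hb2 := b.isLt
      simp [blockMatrix, e, this]
    · simp
  · refine Finset.sum_congr rfl fun j _ => ?_
    have hk := k.isLt
    have h1 : e (Fin.natAdd i j) = ⟨i + j, by omega⟩ := by ext; simp [e]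
    rw [h1]
    have h2 : ¬ (i + (j : ℕ) = k) := by omega
    simp [blockMatrix, h2]

theorem eval_transformed (n i : ℕ) (hi : i < n) (f : MvPolynomial (Fin n) ℚ)
    (a : Fin (n - i) → Fin i → ℝ) (y : Fin n → ℝ) :
    eval y (transformedPoly n i hi f a) =
      aeval (fun m => ∑ k, blockMatrix n i hi a m k * y k) f := by
  unfold transformedPoly
  have := comp_aeval_apply (R := ℚ) (fun m : Fin n => ∑ k : Fin n, C (blockMatrix n i hi a m k) * X k)
    (eval y : MvPolynomial (Fin n) ℝ →+* ℝ).toRatAlgHom f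
  refine this.trans ?_
  congr 2
  funext m
  simp

theorem statement0 (n i : ℕ) (hn : 1 ≤ n) (hi : i < n)
    (f : MvPolynomial (Fin n) ℚ) (hnc : f.totalDegree ≠ 0) (hsf : Squarefree f)
    (hbdd : Bornology.IsBounded {x : Fin n → ℝ | aeval x f = 0}) :
    ∃ O : Set (Fin (n - i) → Fin i → ℝ), IsOpen O ∧ Dense O ∧
      ∀ a ∈ O, ∀ y : Fin n → ℝ,
        eval y (transformedPoly n i hi f a) = 0 →
        (∀ k : Fin i, eval y (pderiv (Fin.castLE hi.le k) (transformedPoly n i hi f a)) = 0) →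
        (∃ m : Fin n, eval y (pderiv m (transformedPoly n i hi f a)) ≠ 0) →
        (Matrix.of fun (l : Fin (i + 1)) (m : Fin n) =>
            eval y (pderiv m
              (Fin.cons (α := fun _ : Fin (i+1) => MvPolynomial (Fin n) ℝ) (transformedPoly n i hi f a)
                (fun k : Fin i =>
                  pderiv (Fin.castLE hi.le k) (transformedPoly n i hi f a)) l))).rank
          = i + 1 := by
  obtain ⟨P, hP0, hP⟩ := bad_poly (n := n) (i := i) (Fin.castLE hi.le)
    (fun j => ⟨i + j, by omega⟩) f
  let Q : MvPolynomial (Fin (n - i) × Fin i) ℝ := map (algebraMap ℚ ℝ) P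
  have hQ0 : Q ≠ 0 := by
    intro h
    exact hP0 (map_injective _ (algebraMap ℚ ℝ).injective (h.trans (map_zero _).symm))
  have hQ : ∀ z, eval z Q = aeval z P := fun z => by
    simp only [Q, eval_map, aeval_def]
  let g : (Fin (n - i) → Fin i → ℝ) ≃ₜ (Fin (n - i) × Fin i → ℝ) :=
    { toFun := fun a s => a s.1 s.2
      invFun := fun b j k => b (j, k)
      left_inv := fun _ => rfl
      right_inv := fun _ => rfl
      continuous_toFun := by fun_prop
      continuous_invFun := by fun_prop }
  refine ⟨g ⁻¹' {z | eval z Q ≠ 0}, ?_, ?_, ?_⟩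
  · refine IsOpen.preimage g.continuous ?_
    exact isOpen_ne_fun (MvPolynomial.continuous_eval Q) continuous_const
  · exact (dense_ne Q hQ0).preimage g.isOpenMap
  intro a ha y hy0 hy1 hy2
  by_contra hr
  apply ha
  rw [hQ]
  refine hP a ?_
  set x : Fin n → ℝ := fun m => ∑ k, blockMatrix n i hi a m k * y k with hx
  have hev : ∀ q, eval y (transformedPoly n i hi q a) = aeval x q :=
    fun q => eval_transformed n i hi q a y
  have hd : ∀ q m, eval y (pderiv m (transformedPoly n i hi q a)) =
      ∑ l, blockMatrix n i hi a l m * aeval x (pderiv l q) := by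
    intro q m
    rw [pderiv_transformed]
    simp [hev]
  have hdd : ∀ m k, eval y (pderiv m (pderiv (Fin.castLE hi.le k) (transformedPoly n i hi f a))) =
      ∑ p, blockMatrix n i hi a p m * (aeval x (pderiv p (pderiv (Fin.castLE hi.le k) f)) +
        ∑ j : Fin (n - i), a j k * aeval x (pderiv p (pderiv ⟨i + j, by omega⟩ f))) := by
    intro m k
    rw [pderiv_transformed]
    have e : ∀ p, (aeval x (pderiv p (pderiv (Fin.castLE hi.le k) f)) +
        ∑ j : Fin (n - i), a j k * aeval x (pderiv p (pderiv ⟨i + j, by omega⟩ f))) =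
        ∑ l, blockMatrix n i hi a l (Fin.castLE hi.le k) * aeval x (pderiv p (pderiv l f)) :=
      fun p => (col_lt n i hi a k (fun l => aeval x (pderiv p (pderiv l f)))).symm
    simp only [e]
    rw [swap_sum (fun p => blockMatrix n i hi a p m)
      (fun l => blockMatrix n i hi a l (Fin.castLE hi.le k))
      (fun p l => aeval x (pderiv p (pderiv l f)))]
    rw [map_sum, map_sum]
    refine Finset.sum_congr rfl fun l _ => ?_
    rw [pderiv_C_mul, map_mul, eval_C, hd]
  -- linear dependence of the rows
  have hli : ¬ LinearIndependent ℝ (Matrix.of fun (l : Fin (i + 1)) (m : Fin n) =>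
            eval y (pderiv m
              (Fin.cons (α := fun _ : Fin (i+1) => MvPolynomial (Fin n) ℝ) (transformedPoly n i hi f a)
                (fun k : Fin i =>
                  pderiv (Fin.castLE hi.le k) (transformedPoly n i hi f a)) l))).row := by
    intro h
    apply hr
    simpa using h.rank_matrix
  rw [Fintype.linearIndependent_iff] at hli
  push Not at hli
  obtain ⟨c, hc, t, ht⟩ := hli
  have hc' : ∀ m, ∑ p, blockMatrix n i hi a p m *
      (c 0 * aeval x (pderiv p f) + ∑ k : Fin i, c k.succ *
        (aeval x (pderiv p (pderiv (Fin.castLE hi.le k) f)) +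
        ∑ j : Fin (n - i), a j k * aeval x (pderiv p (pderiv ⟨i + j, by omega⟩ f)))) = 0 := by
    intro m
    have := congrFun hc m
    simp only [Fin.sum_univ_succ, Pi.add_apply, Finset.sum_apply, Pi.smul_apply, Matrix.row_apply,
      Matrix.of_apply, Fin.cons_zero, Fin.cons_succ, hd, hdd, smul_eq_mul, Pi.zero_apply] at this
    refine Eq.trans ?_ this
    simp only [mul_add (blockMatrix _ _ _ _ _ _) (c 0 * _) _, Finset.sum_add_distrib]
    congr 1
    · rw [Finset.mul_sum]
      exact Finset.sum_congr rfl fun _ _ => by ring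
    · exact swap_sum (fun p => blockMatrix n i hi a p m) (fun k : Fin i => c k.succ)
        (fun p k => aeval x (pderiv p (pderiv (Fin.castLE hi.le k) f)) +
          ∑ j : Fin (n - i), a j k * aeval x (pderiv p (pderiv ⟨i + j, by omega⟩ f)))
  generalize hv : (fun p => c 0 * aeval x (pderiv p f) + ∑ k : Fin i, c k.succ *
        (aeval x (pderiv p (pderiv (Fin.castLE hi.le k) f)) +
        ∑ j : Fin (n - i), a j k * aeval x (pderiv p (pderiv ⟨i + j, by omega⟩ f)))) = v at hc'
  replace hc' : ∀ m, ∑ p, blockMatrix n i hi a p m * v p = 0 := by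
    intro m; rw [← hv]; exact hc' m
  have hv1 : ∀ m : Fin n, i ≤ (m : ℕ) → v m = 0 := fun m hm => by
    rw [← col_ge n i hi a m hm v, hc']
  have hv2 : ∀ m, v m = 0 := by
    intro m
    by_cases hm : i ≤ (m : ℕ)
    · exact hv1 m hm
    · have := hc' (Fin.castLE hi.le ⟨m, by omega⟩)
      rw [col_lt] at this
      simpa [hv1] using this
  refine ⟨x, c 0, fun k => c k.succ, ?_, ?_, ?_, ?_, ?_⟩
  · rw [← hev]; exact hy0
  · intro k
    have := hy1 k
    rw [hd, col_lt n i hi a k (fun l => aeval x (pderiv l f))] at this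
    exact this
  · obtain ⟨m, hm⟩ := hy2
    have him : i ≤ (m : ℕ) := by
      by_contra hlt
      exact hm (hy1 ⟨m, by omega⟩)
    rw [hd, col_ge n i hi a m him (fun l => aeval x (pderiv l f))] at hm
    refine ⟨⟨m - i, by omega⟩, ?_⟩
    convert hm using 4
    ext; simp; omega
  · intro p
    have := hv2 p
    rw [← hv] at this
    exact this
  · rintro ⟨h0, h1⟩
    apply ht
    refine Fin.cases (motive := fun t => c t = 0) h0 h1 t
end

section
/- Fix integers n ≥ 1 and 0 ≤ i < n, and let f ∈ ℚ[X₁,…,Xₙ] be a polynomial. Define the map Φᵢ : ℝⁿ × ℝ^{(n−i)·i} → ℝ^{i+1} by Φᵢ(y, a) = ( f(y), ∂₁f(y) + Σ_{j=i+1}ⁿ a_{j1} ∂ⱼf(y), …, ∂ᵢf(y) + Σ_{j=i+1}ⁿ a_{ji} ∂ⱼf(y) ), where a = (a_{jk})_{i+1 ≤ j ≤ n, 1 ≤ k ≤ i}. If (y⁰, a⁰) satisfies Φᵢ(y⁰, a⁰) = 0 and there exists an index j with i+1 ≤ j ≤ n such that ∂ⱼf(y⁰) ≠ 0, then the Jacobian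 matrix of Φᵢ at (y⁰, a⁰), taken with respect to all n + (n−i)·i arguments, has maximal rank i+1. -/
open MvPolynomial

/-- For `j : Fin (n - i)`, the index of the variable `Y_{i+1+j}` (0-based: `i + j`). -/
def tailIdx (n i : ℕ) (hi : i < n) (j : Fin (n - i)) : Fin n :=
  ⟨i + (j : ℕ), by have := j.isLt; omega⟩

theorem statement1 (n i : ℕ) (hn : 1 ≤ n) (hi : i < n) (f : MvPolynomial (Fin n) ℚ)
    (y0 : Fin n → ℝ) (a0 : Fin (n - i) → Fin i → ℝ)
    -- `Φᵢ(y⁰, a⁰) = 0` : the first component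
    (h0 : aeval y0 f = 0)
    -- and the remaining `i` components
    (hk : ∀ k : Fin i,
      aeval y0 (pderiv (Fin.castLE hi.le k) f)
        + ∑ j : Fin (n - i), a0 j k * aeval y0 (pderiv (tailIdx n i hi j) f) = 0)
    -- there is `i + 1 ≤ j ≤ n` with `∂ⱼf(y⁰) ≠ 0`
    (hj : ∃ j : Fin (n - i), aeval y0 (pderiv (tailIdx n i hi j) f) ≠ 0) :
    -- the Jacobian matrix of `Φᵢ` at `(y⁰, a⁰)` (w.r.t. all `n + (n-i)·i` arguments)
    -- has maximal rank `i + 1`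
    (Matrix.of fun (l : Fin (i + 1)) (c : Fin n ⊕ (Fin (n - i) × Fin i)) =>
      Sum.elim
        -- derivatives with respect to the variables `Y₁, …, Yₙ`
        (fun m : Fin n =>
          Fin.cons (α := fun _ : Fin (i + 1) => ℝ)
            (aeval y0 (pderiv m f))
            (fun k : Fin i =>
              aeval y0 (pderiv m (pderiv (Fin.castLE hi.le k) f))
                + ∑ j : Fin (n - i),
                    a0 j k * aeval y0 (pderiv m (pderiv (tailIdx n i hi j) f))) l)
        -- derivatives with respect to the parameters `a_{jk}`
        (fun p : Fin (n - i) × Fin i =>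
          Fin.cons (α := fun _ : Fin (i + 1) => ℝ)
            0
            (fun k : Fin i =>
              if k = p.2 then aeval y0 (pderiv (tailIdx n i hi p.1) f) else 0) l)
        c).rank = i + 1 := by
  obtain ⟨j, hj⟩ := hj
  refine (LinearIndependent.rank_matrix ?_).trans (Fintype.card_fin _)
  rw [Fintype.linearIndependent_iff]
  intro g hg
  have hs : ∀ k : Fin i, g k.succ = 0 := by
    intro k
    have h := congrFun hg (Sum.inr (j, k))
    simpa [Matrix.row, Fin.sum_univ_succ, hj] using h
  have hz : g 0 = 0 := by
    have h := congrFun hg (Sum.inl (tailIdx n i hi j))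
    simpa [Matrix.row, Fin.sum_univ_succ, hj, hs] using h
  intro l
  exact Fin.cases hz hs l
end

section
/- Let f ∈ ℚ[X₁,…,Xₙ] be a non-constant square-free polynomial, W = {x ∈ ℂⁿ : f(x) = 0}, V = W ∩ ℝⁿ, and Δ = Σ_{j=1}ⁿ (∂ⱼf)². Assume that the gradient of f is nonzero at every point of V. Then V is contained in the polar variety W₀, where W₀ is the Zariski closure in ℂⁿ of the set {x ∈ ℂⁿ : f(x) = 0 and Δ(x) ≠ 0}. -/
open MvPolynomial

/-- The Zariski closure in `ℂⁿ` of a set `S`: the smallest subset of `ℂⁿ` containing `S`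
that is the common zero set of a family of polynomials. -/
def zariskiClosure {n : ℕ} (S : Set (Fin n → ℂ)) : Set (Fin n → ℂ) :=
  {x | ∀ p : MvPolynomial (Fin n) ℂ, (∀ y ∈ S, eval y p = 0) → eval x p = 0}

theorem statement2 (n : ℕ) (f : MvPolynomial (Fin n) ℚ)
    (hnc : f.totalDegree ≠ 0) (hsf : Squarefree f)
    -- the gradient of `f` is nonzero at every point of `V = W ∩ ℝⁿ`
    (hgrad : ∀ x : Fin n → ℝ, aeval x f = 0 → ∃ j : Fin n, aeval x (pderiv j f) ≠ 0) :
    -- `V ⊆ W₀`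
    ∀ x : Fin n → ℝ, aeval x f = 0 →
      (fun k : Fin n => (x k : ℂ)) ∈
        zariskiClosure {z : Fin n → ℂ |
          aeval z f = 0 ∧ aeval z (∑ j : Fin n, (pderiv j f) ^ 2) ≠ 0} := by
  intro x hx p hp
  have key : ∀ q : MvPolynomial (Fin n) ℚ,
      aeval (fun k : Fin n => (x k : ℂ)) q = ((aeval x q : ℝ) : ℂ) := by
    intro q
    exact aeval_algebraMap_apply (A := ℝ) ℂ x q
  apply hp
  refine ⟨by rw [key, hx]; simp, ?_⟩
  rw [key]
  obtain ⟨j, hj⟩ := hgrad x hx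
  have hpos : 0 < aeval x (∑ j : Fin n, (pderiv j f) ^ 2) := by
    simp only [map_sum, map_pow]
    exact Finset.sum_pos' (fun i _ => sq_nonneg _) ⟨j, Finset.mem_univ j, by positivity⟩
  exact_mod_cast hpos.ne'
end

section
/- Let f ∈ ℚ[X₁,…,Xₙ] be a non-constant square-free polynomial, W = {x ∈ ℂⁿ : f(x) = 0}, Δ = Σ_{j=1}ⁿ (∂ⱼf)², and let W₀ be the Zariski closure in ℂⁿ of {x ∈ ℂⁿ : f(x) = 0 and Δ(x) ≠ 0}. Then W₀ = W if and only if f and Δ are relatively prime in ℚ[X₁,…,Xₙ], i.e., have no common non-unit divisor. -/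
open MvPolynomial

section Aux

attribute [local instance] MvPolynomial.algebraMvPolynomial

/-- Coprimality over `ℚ` lets us cancel over `ℂ`. -/
theorem cancel_over_C (n : ℕ) (f d : MvPolynomial (Fin n) ℚ) (h : IsRelPrime f d)
    (p : MvPolynomial (Fin n) ℂ)
    (hp : map (algebraMap ℚ ℂ) f ∣ map (algebraMap ℚ ℂ) d * p) :
    map (algebraMap ℚ ℂ) f ∣ p := by
  have hb : IsBaseChange (MvPolynomial (Fin n) ℚ)
      (IsScalarTower.toAlgHom ℚ ℂ (MvPolynomial (Fin n) ℂ)).toLinearMap :=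
    (inferInstance : Algebra.IsPushout ℚ (MvPolynomial (Fin n) ℚ) ℂ (MvPolynomial (Fin n) ℂ)).out
  let b := hb.basis (Module.Free.chooseBasis ℚ ℂ)
  obtain ⟨q, hq⟩ := hp
  have hq' : d • p = f • q := by
    rw [Algebra.smul_def, Algebra.smul_def]; exact hq
  have key : ∀ i, f ∣ b.repr p i := by
    intro i
    have h1 := congrArg (fun z => b.repr z i) hq'
    simp only [map_smul, Finsupp.smul_apply, smul_eq_mul] at h1
    exact h.dvd_of_dvd_mul_left ⟨_, h1⟩
  rw [← b.linearCombination_repr p, Finsupp.linearCombination_apply]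
  refine Finset.dvd_sum fun i _ => ?_
  obtain ⟨c, hc⟩ := key i
  beta_reduce
  rw [hc, mul_smul, Algebra.smul_def f]
  exact Dvd.intro _ rfl

end Aux

theorem nullst {k : Type*} [Field k] [Algebra k ℂ] (n : ℕ) (g h : MvPolynomial (Fin n) k)
    (H : ∀ z : Fin n → ℂ, aeval z g = 0 → aeval z h = 0) : ∃ m : ℕ, g ∣ h ^ m := by
  have : h ∈ (Ideal.span {g}).radical := by
    rw [← vanishingIdeal_zeroLocus_eq_radical (K := ℂ), mem_vanishingIdeal_iff]
    intro x hx
    exact H x (hx g (Ideal.mem_span_singleton_self g))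
  obtain ⟨m, hm⟩ := this
  exact ⟨m, Ideal.mem_span_singleton.1 hm⟩

theorem statement3 (n : ℕ) (f : MvPolynomial (Fin n) ℚ)
    (hnc : f.totalDegree ≠ 0) (hsf : Squarefree f) :
    -- `W₀ = W` iff `f` and `Δ = ∑ⱼ (∂ⱼf)²` have no common non-unit divisor
    zariskiClosure {z : Fin n → ℂ |
        aeval z f = 0 ∧ aeval z (∑ j : Fin n, (pderiv j f) ^ 2) ≠ 0}
      = {z : Fin n → ℂ | aeval z f = 0}
      ↔ IsRelPrime f (∑ j : Fin n, (pderiv j f) ^ 2) := by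
  generalize (∑ j : Fin n, (pderiv j f) ^ 2) = d
  have hev : ∀ (z : Fin n → ℂ) (g : MvPolynomial (Fin n) ℚ),
      eval z (map (algebraMap ℚ ℂ) g) = aeval z g := fun z g => by
    rw [eval_map, aeval_def]
  constructor
  · intro hW g hgf hgd
    obtain ⟨h, rfl⟩ := hgf
    obtain ⟨e, rfl⟩ := hgd
    have hrel : IsRelPrime g h := (squarefree_mul_iff.1 hsf).1
    obtain ⟨m, hm⟩ := nullst n g h (fun z hz => by
      have hz' : z ∈ {z : Fin n → ℂ | aeval z (g * h) = 0} := by simp [hz]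
      rw [← hW] at hz'
      have := hz' (map (algebraMap ℚ ℂ) h) (by
        rintro y ⟨hy1, hy2⟩
        rw [hev]
        rw [map_mul] at hy1 hy2
        exact (mul_eq_zero.1 hy1).resolve_left (left_ne_zero_of_mul hy2))
      rwa [hev] at this)
    exact (hrel.pow_right (n := m)) dvd_rfl hm
  · intro hrel
    apply Set.Subset.antisymm
    · intro z hz
      have := hz (map (algebraMap ℚ ℂ) f) (fun y hy => by rw [hev]; exact hy.1)
      rwa [hev] at this
    · intro z hz p hp
      obtain ⟨m, hm⟩ := nullst n (map (algebraMap ℚ ℂ) f) (map (algebraMap ℚ ℂ) d * p)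
        (fun y hy => by
          rw [aeval_eq_eval] at hy ⊢
          change eval y _ = 0 at hy
          change eval y _ = 0
          rw [hev] at hy
          rw [map_mul, hev]
          by_cases hd : aeval y d = 0
          · rw [hd, zero_mul]
          · rw [hp y ⟨hy, hd⟩, mul_zero])
      rw [mul_pow, ← map_pow] at hm
      obtain ⟨q, hq⟩ := cancel_over_C n f (d ^ m) hrel.pow_right _ hm
      have h2 := congrArg (eval z) hq
      rw [map_pow, map_mul, hev, show aeval z f = 0 from hz, zero_mul] at h2
      exact eq_zero_of_pow_eq_zero h2
end

section
/- Fix 0 ≤ i < n. Let f ∈ ℚ[X₁,…,Xₙ] be a non-constant square-free polynomial, Δ = Σ_{j=1}ⁿ (∂ⱼf)², W̃ᵢ = {x ∈ ℂⁿ : f(x) = ∂₁f(x) = ⋯ = ∂ᵢf(x) = 0}, and let Wᵢ be the Zariski closure in ℂⁿ of W̃ᵢ ∖ {x : Δ(x) = 0}. Assume that W̃ᵢ ∖ {x : Δ(x) = 0} is non-empty and that at every point x ∈ W̃ᵢ with Δ(x) ≠ 0 the Jacobian matrix of the system (f, ∂₁f, …, ∂ᵢf) at x has maximal rank i+1 (as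 holds when the variables are in generic position). Then Wᵢ is a non-empty equidimensional affine variety of dimension n−(i+1): every irreducible component of Wᵢ, with respect to the Zariski topology, has dimension n−(i+1). -/
open MvPolynomial

/-- A Zariski-closed (algebraic) subset of `ℂⁿ`: the common zero set of a family of
polynomials. -/
def IsAlgebraicSet {n : ℕ} (C : Set (Fin n → ℂ)) : Prop :=
  ∃ S : Set (MvPolynomial (Fin n) ℂ), C = {x | ∀ p ∈ S, eval x p = 0}

/-- An irreducible Zariski-closed subset of `ℂⁿ`: a non-empty algebraic set that is not
contained in the union of two algebraic sets unless it is contained in one of them. -/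
def IsIrreducibleAlgebraicSet {n : ℕ} (C : Set (Fin n → ℂ)) : Prop :=
  IsAlgebraicSet C ∧ C.Nonempty ∧
    ∀ Z₁ Z₂ : Set (Fin n → ℂ), IsAlgebraicSet Z₁ → IsAlgebraicSet Z₂ →
      C ⊆ Z₁ ∪ Z₂ → C ⊆ Z₁ ∨ C ⊆ Z₂

/-- `C` is an irreducible component (w.r.t. the Zariski topology) of `W`: a maximal
irreducible Zariski-closed subset of `W`. -/
def IsIrreducibleComponentOf {n : ℕ} (C W : Set (Fin n → ℂ)) : Prop :=
  IsIrreducibleAlgebraicSet C ∧ C ⊆ W ∧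
    ∀ C' : Set (Fin n → ℂ), IsIrreducibleAlgebraicSet C' → C' ⊆ W → C ⊆ C' → C' = C

/-- The (Krull) dimension of a subset of `ℂⁿ` w.r.t. the Zariski topology : the Krull
dimension of the poset of irreducible Zariski-closed subsets contained in it. -/
noncomputable def algebraicSetDim {n : ℕ} (C : Set (Fin n → ℂ)) : WithBot ℕ∞ :=
  Order.krullDim {D : Set (Fin n → ℂ) // IsIrreducibleAlgebraicSet D ∧ D ⊆ C}

/-- The set `W̃ᵢ ∖ {Δ = 0} = {x ∈ ℂⁿ : f(x) = ∂₁f(x) = ⋯ = ∂ᵢf(x) = 0, Δ(x) ≠ 0}`. -/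
def polarCore (n i : ℕ) (hi : i < n) (f : MvPolynomial (Fin n) ℚ) : Set (Fin n → ℂ) :=
  {x | aeval x f = 0 ∧ (∀ k : Fin i, aeval x (pderiv (Fin.castLE hi.le k) f) = 0) ∧
    aeval x (∑ j : Fin n, (pderiv j f) ^ 2) ≠ 0}

/-- The Jacobian matrix of the system `(f, ∂₁f, …, ∂ᵢf)` at a point `x ∈ ℂⁿ`. -/
noncomputable def jacobianMat (n i : ℕ) (hi : i < n) (f : MvPolynomial (Fin n) ℚ)
    (x : Fin n → ℂ) : Matrix (Fin (i + 1)) (Fin n) ℂ :=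
  Matrix.of fun l m =>
    aeval x (pderiv m
      (Fin.cons (α := fun _ : Fin (i + 1) => MvPolynomial (Fin n) ℚ) f
        (fun k : Fin i => pderiv (Fin.castLE hi.le k) f) l))

lemma pderiv_sq_mem {n : ℕ} (Q : Ideal (MvPolynomial (Fin n) ℂ)) (m : Fin n) (p : MvPolynomial (Fin n) ℂ) (hp : p ∈ Q ^ 2) :
    pderiv m p ∈ Q := by
  rw [pow_two] at hp
  induction hp using Submodule.mul_induction_on' with
  | mem_mul_mem a ha b hb =>
    rw [Derivation.leibniz]
    exact Q.add_mem (Q.mul_mem_right _ ha) (Q.mul_mem_right _ hb)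
  | add x hx y hy h1 h2 => rw [map_add]; exact Q.add_mem h1 h2

lemma height_lower {n r : ℕ} (Q : Ideal (MvPolynomial (Fin n) ℂ)) [hQ : Q.IsPrime]
    (g : Fin r → MvPolynomial (Fin n) ℂ) (hg : ∀ j, g j ∈ Q)
    (hJ : ∀ a : Fin r → MvPolynomial (Fin n) ℂ, (∀ m, ∑ j, a j * pderiv m (g j) ∈ Q) → ∀ j, a j ∈ Q) :
    (r : ℕ∞) ≤ Q.height := by
  let A := Localization.AtPrime Q
  have hreg : IsRegularLocalRing A := inferInstance
  have h1 := (IsRegularLocalRing.iff_finrank_cotangentSpace A).1 hreg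
  rw [IsLocalization.AtPrime.ringKrullDim_eq_height Q A] at h1
  have hmem : ∀ j, algebraMap _ A (g j) ∈ IsLocalRing.maximalIdeal A := fun j => by
    rw [← Localization.AtPrime.map_eq_maximalIdeal]
    exact Ideal.mem_map_of_mem _ (hg j)
  let v : Fin r → IsLocalRing.CotangentSpace A := fun j =>
    (IsLocalRing.maximalIdeal A).toCotangent ⟨algebraMap _ A (g j), hmem j⟩
  have hv : LinearIndependent (IsLocalRing.ResidueField A) v := by
    rw [Fintype.linearIndependent_iff]
    intro c hc
    choose c' hc' using fun j => IsLocalRing.residue_surjective (c j)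
    obtain ⟨b, hb⟩ := IsLocalization.exist_integer_multiples_of_finite Q.primeCompl c'
    choose a ha using hb
    have hsum : ∑ j, c' j • v j = 0 := by
      rw [← hc]
      refine Finset.sum_congr rfl fun j _ => ?_
      rw [← hc']
      rfl
    have h2 : ∑ j, c' j * algebraMap _ A (g j) ∈ IsLocalRing.maximalIdeal A ^ 2 := by
      have : ∑ j, c' j • v j = (IsLocalRing.maximalIdeal A).toCotangent
          (∑ j, c' j • ⟨algebraMap _ A (g j), hmem j⟩) := by
        rw [map_sum]
        exact Finset.sum_congr rfl fun j _ => (map_smul _ _ _).symm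
      rw [this, Ideal.toCotangent_eq_zero] at hsum
      simpa using hsum
    have h3 : algebraMap _ A (∑ j, a j * g j) ∈ (Q ^ 2).map (algebraMap _ A) := by
      rw [Ideal.map_pow, Localization.AtPrime.map_eq_maximalIdeal]
      have : algebraMap _ A (∑ j, a j * g j) = algebraMap _ A (b : MvPolynomial (Fin n) ℂ) * ∑ j, c' j * algebraMap _ A (g j) := by
        rw [map_sum, Finset.mul_sum]
        refine Finset.sum_congr rfl fun j _ => ?_
        rw [map_mul, ha, Algebra.smul_def, mul_assoc]
      rw [this]
      exact Ideal.mul_mem_left _ _ h2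
    rw [IsLocalization.algebraMap_mem_map_algebraMap_iff Q.primeCompl] at h3
    obtain ⟨s, hs, h3⟩ := h3
    have h4 := hJ (fun j => s * a j) (fun m => by
      have h5 := pderiv_sq_mem Q m _ h3
      have h6 : pderiv m (s * ∑ j, a j * g j) = ∑ j, s * a j * pderiv m (g j)
          + ∑ j, g j * pderiv m (s * a j) := by
        rw [Finset.mul_sum, map_sum, ← Finset.sum_add_distrib]
        refine Finset.sum_congr rfl fun j _ => ?_
        rw [← mul_assoc, Derivation.leibniz]
        simp
      rw [h6] at h5
      exact (Ideal.add_mem_iff_left _ (Q.sum_mem fun j _ => Q.mul_mem_right _ (hg j))).1 h5)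
    intro j
    have h7 : a j ∈ Q := (hQ.mem_or_mem (h4 j)).resolve_left hs
    rw [← hc', IsLocalRing.residue_eq_zero_iff]
    have h8 : algebraMap _ A (a j) ∈ IsLocalRing.maximalIdeal A := by
      rw [← Localization.AtPrime.map_eq_maximalIdeal]
      exact Ideal.mem_map_of_mem _ h7
    rw [ha, Algebra.smul_def] at h8
    refine ((IsLocalRing.maximalIdeal.isMaximal A).isPrime.mem_or_mem h8).resolve_left ?_
    intro h9
    exact h9 (IsLocalization.map_units A b)
  have h2 := hv.fintype_card_le_finrank
  rw [Fintype.card_fin] at h2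
  have h3 : ((Module.finrank (IsLocalRing.ResidueField A) (IsLocalRing.CotangentSpace A) : ℕ∞)) = Q.height := by
    exact_mod_cast h1
  rw [← h3]
  exact_mod_cast h2

lemma height_point {n : ℕ} (x : Fin n → ℂ) :
    (n : ℕ∞) ≤ (vanishingIdeal ℂ {x} : Ideal (MvPolynomial (Fin n) ℂ)).height := by
  refine height_lower _ (fun j => X j - C (x j)) (fun j => ?_) (fun a ha j => ?_)
  · rw [mem_vanishingIdeal_singleton_iff]; simp
  · have := ha j
    simpa [pderiv_X, Pi.single_apply] using this

lemma height_add_dim {R : Type*} [CommRing R] (Q : Ideal R) [hQ : Q.IsPrime] :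
    (Q.height : WithBot ℕ∞) + ringKrullDim (R ⧸ Q) ≤ ringKrullDim R := by
  have : Nonempty (PrimeSpectrum R) := ⟨⟨Q, hQ⟩⟩
  have h : PrimeSpectrum.zeroLocus (Q : Set R) = Set.Ici (⟨Q, hQ⟩ : PrimeSpectrum R) := by
    ext p; rfl
  rw [ringKrullDim_quotient, h, ← Order.coheight_eq_krullDim_Ici, ringKrullDim,
    Order.krullDim_eq_iSup_height_add_coheight_of_nonempty,
    show Q.height = Order.height (⟨Q, hQ⟩ : PrimeSpectrum R) from
      PrimeSpectrum.height_eq_orderHeight ⟨Q, hQ⟩]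
  norm_cast
  exact le_iSup (fun a : PrimeSpectrum R => Order.height a + Order.coheight a) _

lemma dim_lower {n r : ℕ} (g : Fin r → MvPolynomial (Fin n) ℂ)
    (Q : Ideal (MvPolynomial (Fin n) ℂ)) (hQ : Q ∈ (Ideal.span (Set.range g)).minimalPrimes) :
    (n : WithBot ℕ∞) ≤ ringKrullDim (MvPolynomial (Fin n) ℂ ⧸ Q) + r := by
  classical
  set J := Ideal.span (Set.range g) with hJ
  have hQp : Q.IsPrime := hQ.1.1
  have hfin := Ideal.finite_minimalPrimes_of_isNoetherianRing (MvPolynomial (Fin n) ℂ) J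
  have h1 : ¬ (hfin.toFinset.erase Q).inf id ≤ Q := by
    rw [Ideal.IsPrime.inf_le' hQp]
    rintro ⟨P, hP, hPQ⟩
    rw [Finset.mem_erase, Set.Finite.mem_toFinset] at hP
    exact hP.1 (le_antisymm hPQ (hQ.2 hP.2.1 hPQ))
  obtain ⟨h, hh, hhQ⟩ := SetLike.not_le_iff_exists.1 h1
  rw [← IsPrime.vanishingIdeal_zeroLocus (K := ℂ) Q] at hhQ
  simp only [mem_vanishingIdeal_iff, not_forall] at hhQ
  obtain ⟨x, hx, hhx⟩ := hhQ
  set m : Ideal (MvPolynomial (Fin n) ℂ) := vanishingIdeal ℂ {x} with hm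
  have hmp : m.IsPrime := by rw [hm]; infer_instance
  have hQm : Q ≤ m := fun p hp => (mem_vanishingIdeal_singleton_iff x p).2 (hx p hp)
  have hJm : J ≤ m := hQ.1.2.trans hQm
  have huniq : ∀ P : Ideal (MvPolynomial (Fin n) ℂ), P.IsPrime → J ≤ P → P ≤ m → Q ≤ P := by
    intro P hP hJP hPm
    obtain ⟨P', hP', hle⟩ := Ideal.exists_minimalPrimes_le hJP
    by_cases heq : P' = Q
    · exact heq ▸ hle
    · exfalso
      have : h ∈ P' := (Finset.inf_le (f := id)
        (Finset.mem_erase.2 ⟨heq, hfin.mem_toFinset.2 hP'⟩) : _ ≤ P') hh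
      exact hhx ((mem_vanishingIdeal_singleton_iff x h).1 (hPm (hle this)))
  have hk := Ideal.height_le_height_add_spanFinrank_of_le hJm
  have hsf : J.spanFinrank ≤ r := by
    refine (Submodule.spanFinrank_span_le_ncard_of_finite (Set.finite_range g)).trans ?_
    rw [← Set.image_univ]
    refine (Set.ncard_image_le).trans ?_
    simp
  have hmap : (m.map (Ideal.Quotient.mk J)).IsPrime := Ideal.isPrime_map_quotientMk_of_isPrime hJm
  have hdim : ((m.map (Ideal.Quotient.mk J)).height : WithBot ℕ∞) ≤
      ringKrullDim (MvPolynomial (Fin n) ℂ ⧸ Q) := by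
    rw [show (m.map (Ideal.Quotient.mk J)).height =
      Order.height (⟨_, hmap⟩ : PrimeSpectrum (MvPolynomial (Fin n) ℂ ⧸ J)) from
      PrimeSpectrum.height_eq_orderHeight ⟨_, hmap⟩, Order.height_eq_krullDim_Iic,
      ringKrullDim_quotient]
    refine Order.krullDim_le_of_strictMono
      (fun q => ⟨PrimeSpectrum.comap (Ideal.Quotient.mk J) q.1, ?_⟩) ?_
    · refine huniq _ inferInstance ?_ ?_
      · intro p hp
        change Ideal.Quotient.mk J p ∈ q.1.asIdeal
        rw [Ideal.Quotient.eq_zero_iff_mem.2 hp]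
        exact zero_mem _
      · have h2 : q.1.asIdeal ≤ m.map (Ideal.Quotient.mk J) := q.2
        refine (Ideal.comap_mono h2).trans ?_
        rw [Ideal.comap_map_of_surjective _ Ideal.Quotient.mk_surjective]
        refine sup_le le_rfl ?_
        rw [← RingHom.ker_eq_comap_bot, Ideal.mk_ker]
        exact hJm
    · refine Monotone.strictMono_of_injective ?_ ?_
      · intro a b hab
        exact Ideal.comap_mono (show a.1.asIdeal ≤ b.1.asIdeal from hab)
      · intro a b hab
        have := congrArg Subtype.val hab
        exact Subtype.ext (PrimeSpectrum.comap_injective_of_surjective _ Ideal.Quotient.mk_surjective this)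
  have h5 : (n : ℕ∞) ≤ (m.map (Ideal.Quotient.mk J)).height + r :=
    (height_point x).trans (hk.trans (by gcongr))
  calc (n : WithBot ℕ∞) ≤ ((m.map (Ideal.Quotient.mk J)).height : WithBot ℕ∞) + r := by exact_mod_cast h5
    _ ≤ _ := by gcongr

lemma aev {n : ℕ} (x : Fin n → ℂ) (p : MvPolynomial (Fin n) ℂ) : aeval x p = eval x p := by
  rw [← coe_aeval_eq_eval]; rfl

lemma algSet_zeroLocus {n : ℕ} (I : Ideal (MvPolynomial (Fin n) ℂ)) :
    IsAlgebraicSet (MvPolynomial.zeroLocus ℂ I) :=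
  ⟨I, by ext x; simp [aev]⟩

lemma zeroLocus_vanishing {n : ℕ} {D : Set (Fin n → ℂ)} (hD : IsAlgebraicSet D) :
    MvPolynomial.zeroLocus ℂ (vanishingIdeal ℂ D) = D := by
  obtain ⟨S, rfl⟩ := hD
  refine le_antisymm (fun x hx p hp => ?_) (zeroLocus_vanishingIdeal_le _)
  rw [← aev]
  exact hx p (fun y hy => by rw [aev]; exact hy p hp)

lemma vanishing_isPrime {n : ℕ} {D : Set (Fin n → ℂ)} (hD : IsIrreducibleAlgebraicSet D) :
    (vanishingIdeal ℂ D : Ideal (MvPolynomial (Fin n) ℂ)).IsPrime := by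
  obtain ⟨h1, ⟨x, hx⟩, h3⟩ := hD
  refine ⟨?_, ?_⟩
  · rw [Ideal.ne_top_iff_one]
    intro h
    simpa using h x hx
  · intro p q hpq
    have := h3 {y | ∀ u ∈ ({p} : Set (MvPolynomial (Fin n) ℂ)), eval y u = 0}
      {y | ∀ u ∈ ({q} : Set (MvPolynomial (Fin n) ℂ)), eval y u = 0} ⟨_, rfl⟩ ⟨_, rfl⟩ (by
        intro y hy
        have := hpq y hy
        simpa [aev] using this)
    refine this.imp (fun h y hy => ?_) (fun h y hy => ?_)
    · rw [aev]; exact h hy p rfl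
    · rw [aev]; exact h hy q rfl

lemma zeroLocus_irred {n : ℕ} (P : Ideal (MvPolynomial (Fin n) ℂ)) [hP : P.IsPrime] :
    IsIrreducibleAlgebraicSet (MvPolynomial.zeroLocus ℂ P) := by
  have hv := IsPrime.vanishingIdeal_zeroLocus (K := ℂ) P
  refine ⟨algSet_zeroLocus P, ?_, ?_⟩
  · by_contra h
    rw [Set.not_nonempty_iff_eq_empty] at h
    rw [h, vanishingIdeal_empty] at hv
    exact hP.ne_top hv.symm
  · intro Z₁ Z₂ h1 h2 hsub
    rw [← zeroLocus_vanishing h1, ← zeroLocus_vanishing h2]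
    have hmul : vanishingIdeal ℂ Z₁ * vanishingIdeal ℂ Z₂ ≤ P := by
      rw [Ideal.mul_le]
      intro p hp q hq
      rw [← hv]
      intro x hx
      rw [map_mul]
      rcases hsub hx with h | h
      · rw [hp x h, zero_mul]
      · rw [hq x h, mul_zero]
    rcases hP.mul_le.1 hmul with h | h
    · exact Or.inl (zeroLocus_anti_mono h)
    · exact Or.inr (zeroLocus_anti_mono h)

lemma algDim_eq {n : ℕ} {C : Set (Fin n → ℂ)} (hC : IsAlgebraicSet C) :
    algebraicSetDim C =
      ringKrullDim (MvPolynomial (Fin n) ℂ ⧸ (vanishingIdeal ℂ C : Ideal (MvPolynomial (Fin n) ℂ))) := by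
  rw [ringKrullDim_quotient, algebraicSetDim, ← Order.krullDim_orderDual]
  refine Order.krullDim_eq_of_orderIso
    { toFun := fun D => ⟨⟨vanishingIdeal ℂ (OrderDual.ofDual D).1, vanishing_isPrime (OrderDual.ofDual D).2.1⟩,
        vanishingIdeal_anti_mono (OrderDual.ofDual D).2.2⟩
      invFun := fun P => OrderDual.toDual ⟨MvPolynomial.zeroLocus ℂ P.1.asIdeal, zeroLocus_irred _, by
        exact (zeroLocus_anti_mono P.2).trans (zeroLocus_vanishing hC).le⟩
      left_inv := fun D => ?_
      right_inv := fun P => ?_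
      map_rel_iff' := ?_ }
  · exact Subtype.ext (zeroLocus_vanishing (OrderDual.ofDual D).2.1.1)
  · exact Subtype.ext (PrimeSpectrum.ext (IsPrime.vanishingIdeal_zeroLocus (K := ℂ) P.1.asIdeal))
  · intro D E
    change vanishingIdeal ℂ (OrderDual.ofDual D).1 ≤ vanishingIdeal ℂ (OrderDual.ofDual E).1 ↔
      (OrderDual.ofDual E).1 ≤ (OrderDual.ofDual D).1
    refine ⟨fun h => ?_, fun h => vanishingIdeal_anti_mono h⟩
    rw [← zeroLocus_vanishing (OrderDual.ofDual D).2.1.1, ← zeroLocus_vanishing (OrderDual.ofDual E).2.1.1]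
    exact zeroLocus_anti_mono h

lemma main_aux {n r : ℕ} (g : Fin r → MvPolynomial (Fin n) ℂ) (D : MvPolynomial (Fin n) ℂ)
    (S : Set (Fin n → ℂ)) (hS : S = {x | (∀ j, eval x (g j) = 0) ∧ eval x D ≠ 0})
    (hjac : ∀ x ∈ S, LinearIndependent ℂ (fun j m => eval x (pderiv m (g j)) : Fin r → Fin n → ℂ))
    (C : Set (Fin n → ℂ)) (hC : IsIrreducibleComponentOf C (zariskiClosure S)) :
    algebraicSetDim C = ((n - r : ℕ) : WithBot ℕ∞) := by
  classical
  obtain ⟨hirr, hsub, hmax⟩ := hC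
  set P : Ideal (MvPolynomial (Fin n) ℂ) := vanishingIdeal ℂ C with hPdef
  have hP : P.IsPrime := vanishing_isPrime hirr
  set J := Ideal.span (Set.range g) with hJ
  have hfin := Ideal.finite_minimalPrimes_of_isNoetherianRing (MvPolynomial (Fin n) ℂ) J
  -- a minimal prime of `J` not containing `D` and contained in `P`
  have hex : ∃ Q ∈ J.minimalPrimes, D ∉ Q ∧ Q ≤ P := by
    have h1 : (hfin.toFinset.filter (fun Q => D ∉ Q)).inf id ≤ P := by
      intro p hp x hx
      rw [aev]
      refine hsub hx p (fun y hy => ?_)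
      rw [hS] at hy
      have hJy : J ≤ vanishingIdeal ℂ {y} := by
        rw [hJ, Ideal.span_le]
        rintro _ ⟨j, rfl⟩
        exact (mem_vanishingIdeal_singleton_iff y _).2 (by rw [aev]; exact hy.1 j)
      obtain ⟨Q, hQ, hle⟩ := Ideal.exists_minimalPrimes_le hJy
      have hDQ : D ∉ Q := fun h => hy.2 (by
        rw [← aev]; exact (mem_vanishingIdeal_singleton_iff y _).1 (hle h))
      have : p ∈ Q := (Finset.inf_le (f := id)
        (Finset.mem_filter.2 ⟨hfin.mem_toFinset.2 hQ, hDQ⟩) : _ ≤ Q) hp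
      rw [← aev]; exact (mem_vanishingIdeal_singleton_iff y _).1 (hle this)
    rw [hP.inf_le'] at h1
    obtain ⟨Q, hQ, hle⟩ := h1
    rw [Finset.mem_filter, hfin.mem_toFinset] at hQ
    exact ⟨Q, hQ.1, hQ.2, hle⟩
  obtain ⟨Q, hQ, hDQ, hQP⟩ := hex
  have hQp : Q.IsPrime := hQ.1.1
  have hv := IsPrime.vanishingIdeal_zeroLocus (K := ℂ) Q
  have hgQ : ∀ j, g j ∈ Q := fun j => hQ.1.2 (Ideal.subset_span ⟨j, rfl⟩)
  -- vanishing on the core part of `V(Q)` implies membership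
  have hkey : ∀ p, (∀ x ∈ MvPolynomial.zeroLocus ℂ Q, x ∈ S → eval x p = 0) → p ∈ Q := by
    intro p hp
    have : p * D ∈ Q := by
      rw [← hv]
      intro x hx
      rw [map_mul]
      by_cases hd : eval x D = 0
      · rw [aev x D, hd, mul_zero]
      · rw [aev x p, hp x hx, zero_mul]
        rw [hS]
        exact ⟨fun j => by rw [← aev]; exact hx _ (hgQ j), hd⟩
    exact (hQp.mem_or_mem this).resolve_right hDQ
  have hCQ : MvPolynomial.zeroLocus ℂ Q = C := by
    refine hmax _ (zeroLocus_irred Q) ?_ ?_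
    · intro x hx p hp
      rw [← aev]
      exact hx p (hkey p fun y _ hy => hp y hy)
    · rw [← zeroLocus_vanishing hirr.1]; exact zeroLocus_anti_mono hQP
  have hPQ : P = Q := by rw [hPdef, ← hCQ, hv]
  rw [algDim_eq hirr.1, ← hPdef, hPQ]
  have hlow := dim_lower g Q hQ
  have hht : (r : ℕ∞) ≤ Q.height := by
    refine height_lower Q g hgQ (fun a ha j => ?_)
    refine hkey _ (fun x hx hxS => ?_)
    have hli := Fintype.linearIndependent_iff.1 (hjac x hxS) (fun j => eval x (a j)) ?_ j
    · exact hli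
    · funext m
      have := hx _ (ha m)
      rw [aev, map_sum] at this
      simpa using this
  have hup : (Q.height : WithBot ℕ∞) + ringKrullDim (MvPolynomial (Fin n) ℂ ⧸ Q) ≤ n := by
    refine (height_add_dim Q).trans ?_
    rw [MvPolynomial.ringKrullDim_of_isNoetherianRing]
    simp
  have hup' : (r : WithBot ℕ∞) + ringKrullDim (MvPolynomial (Fin n) ℂ ⧸ Q) ≤ n := by
    refine le_trans ?_ hup
    gcongr
    exact_mod_cast hht
  have hnn : (0 : WithBot ℕ∞) ≤ ringKrullDim (MvPolynomial (Fin n) ℂ ⧸ Q) := by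
    have : Nontrivial (MvPolynomial (Fin n) ℂ ⧸ Q) := Ideal.Quotient.nontrivial_iff.2 hQp.ne_top
    exact ringKrullDim_nonneg_of_nontrivial
  generalize ringKrullDim (MvPolynomial (Fin n) ℂ ⧸ Q) = d at *
  induction d with
  | bot => simp at hnn
  | coe d =>
    induction d with
    | top =>
      exfalso
      have : ((r : ℕ∞) + ⊤) ≤ (n : ℕ∞) := by exact_mod_cast hup'
      simp at this
    | coe d =>
      have h1 : r + d ≤ n := by exact_mod_cast hup'
      have h2 : n ≤ d + r := by exact_mod_cast hlow
      have : d = n - r := by omega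
      rw [this]; rfl

theorem statement4 (n i : ℕ) (hi : i < n) (f : MvPolynomial (Fin n) ℚ)
    (hnc : f.totalDegree ≠ 0) (hsf : Squarefree f)
    (hne : (polarCore n i hi f).Nonempty)
    (hjac : ∀ x ∈ polarCore n i hi f, (jacobianMat n i hi f x).rank = i + 1) :
    (zariskiClosure (polarCore n i hi f)).Nonempty ∧
      ∀ C : Set (Fin n → ℂ), IsIrreducibleComponentOf C (zariskiClosure (polarCore n i hi f)) →
        algebraicSetDim C = ((n - (i + 1) : ℕ) : WithBot ℕ∞) := by
  have hmap : ∀ (x : Fin n → ℂ) (p : MvPolynomial (Fin n) ℚ),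
      eval x (map (algebraMap ℚ ℂ) p) = aeval x p := fun x p => by
    rw [eval_map, aeval_def]
  refine ⟨?_, fun C hC => ?_⟩
  · obtain ⟨x, hx⟩ := hne
    exact ⟨x, fun p hp => hp x hx⟩
  · refine main_aux (r := i + 1) (fun l => map (algebraMap ℚ ℂ)
      (Fin.cons (α := fun _ : Fin (i + 1) => MvPolynomial (Fin n) ℚ) f
        (fun k : Fin i => pderiv (Fin.castLE hi.le k) f) l))
      (map (algebraMap ℚ ℂ) (∑ j : Fin n, (pderiv j f) ^ 2)) _ ?_ ?_ C hC
    · ext x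
      simp only [hmap, Fin.forall_fin_succ, Fin.cons_zero, Fin.cons_succ, polarCore,
        Set.mem_ofPred_eq, and_assoc]
    · intro x hx
      have h := hjac x hx
      simp only [pderiv_map, hmap]
      have : LinearIndependent ℂ (jacobianMat n i hi f x).row := by
        rw [Matrix.rank_eq_finrank_span_row] at h
        rw [linearIndependent_iff_card_eq_finrank_span, Set.finrank, h, Fintype.card_fin]
      exact this
end

section
/- Fix 0 ≤ i < n. Let f ∈ ℚ[X₁,…,Xₙ] be a non-constant square-free polynomial whose real zero set V = {x ∈ ℝⁿ : f(x) = 0} is non-empty, bounded, and on which the gradient of f never vanishes. Let Δ = Σ_{j=1}ⁿ (∂ⱼf)², W̃ᵢ = {x ∈ ℂⁿ : f(x) = ∂₁f(x) = ⋯ = ∂ᵢf(x) = 0}, Wᵢ the Zariski closure in ℂⁿ of W̃ᵢ ∖ {Δ = 0}, and Vᵢ = {x ∈ ℝⁿ : f(x) = ∂₁f(x) = ⋯ = ∂ᵢf(x) = 0}. Assume Vᵢ is non-empty and that at every point x ∈ W̃ᵢ with Δ(x) ≠ 0 the Jacobian matrix of (f, ∂₁f, …, ∂ᵢf) at x has maximal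 rank i+1 (as holds when the variables are in generic position). Then the union of those irreducible components C of Wᵢ for which C ∩ ℝⁿ contains a point where the Jacobian matrix of (f, ∂₁f, …, ∂ᵢf) has rank i+1 (i.e., the real part Wᵢ* of the polar variety Wᵢ) coincides with the Zariski closure in ℂⁿ of Vᵢ. -/
open MvPolynomial

/-- The Jacobian matrix of the system `(f, ∂₁f, …, ∂ᵢf)` at a real point `x ∈ ℝⁿ`. -/
noncomputable def jacobianMatR (n i : ℕ) (hi : i < n) (f : MvPolynomial (Fin n) ℚ)
    (x : Fin n → ℝ) : Matrix (Fin (i + 1)) (Fin n) ℝ :=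
  Matrix.of fun l m =>
    aeval x (pderiv m
      (Fin.cons (α := fun _ : Fin (i + 1) => MvPolynomial (Fin n) ℚ) f
        (fun k : Fin i => pderiv (Fin.castLE hi.le k) f) l))

/-- Inclusion `ℝⁿ → ℂⁿ`. -/
def toCPoint {n : ℕ} (x : Fin n → ℝ) : Fin n → ℂ := fun k => (x k : ℂ)

section AuxLemmas

open Topology Filter Asymptotics

theorem aux_strict {n : ℕ} (p : MvPolynomial (Fin n) ℝ) (x : Fin n → ℝ) :
    HasStrictFDerivAt (fun y : Fin n → ℝ => eval y p)
      (∑ j, eval x (pderiv j p) • (ContinuousLinearMap.proj j : (Fin n → ℝ) →L[ℝ] ℝ)) x := by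
  induction p using MvPolynomial.induction_on with
  | C a => simpa using hasStrictFDerivAt_const a x
  | add p q hp hq =>
    have := hp.add hq
    simp only [map_add, add_smul, Finset.sum_add_distrib]
    exact this
  | mul_X p i hp =>
    have := hp.mul' (hasStrictFDerivAt_apply i x)
    simp only [map_mul, eval_X]
    refine this.congr_fderiv ?_
    ext v
    simp [pderiv_X, Pi.single_apply, add_mul, Finset.sum_add_distrib, Finset.mul_sum]
    simp [Finset.sum_ite_eq, apply_ite, ite_mul]
    simp only [mul_comm, mul_left_comm]

theorem aux_univ (Q : Polynomial ℝ) (k : ℕ)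
    (h : (fun t : ℝ => Q.eval t) =o[𝓝 0] (fun t => t ^ k)) : Polynomial.X ^ (k + 1) ∣ Q := by
  induction k generalizing Q with
  | zero =>
    rw [zero_add, pow_one, Polynomial.X_dvd_iff, Polynomial.coeff_zero_eq_eval_zero]
    have h1 : Tendsto (fun t : ℝ => Q.eval t) (𝓝 0) (𝓝 0) := by
      simpa using h
    exact tendsto_nhds_unique (Q.continuous.tendsto 0) h1
  | succ k ih =>
    have h0 : Polynomial.X ^ (k + 1) ∣ Q := by
      refine ih Q (h.trans_isBigO ?_)
      refine IsBigO.of_bound 1 ?_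
      filter_upwards [Metric.ball_mem_nhds (0 : ℝ) one_pos] with t ht
      have ht' : |t| ≤ 1 := by simpa using (mem_ball_zero_iff.1 ht).le
      rw [one_mul, norm_pow, norm_pow, pow_succ]
      exact mul_le_of_le_one_right (by positivity) ht'
    obtain ⟨R, rfl⟩ := h0
    have h1 : R.eval 0 = 0 := by
      have h2 : Tendsto (fun t : ℝ => R.eval t) (𝓝[≠] 0) (𝓝 0) := by
        have h3 := (h.mono (nhdsWithin_le_nhds (s := {0}ᶜ))).tendsto_div_nhds_zero
        refine h3.congr' ?_
        filter_upwards [self_mem_nhdsWithin] with t ht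
        have ht' : t ≠ 0 := ht
        simp only [Polynomial.eval_mul, Polynomial.eval_pow, Polynomial.eval_X]
        field_simp
      exact tendsto_nhds_unique ((R.continuous.tendsto 0).mono_left nhdsWithin_le_nhds) h2
    rw [← Polynomial.coeff_zero_eq_eval_zero, ← Polynomial.X_dvd_iff] at h1
    rw [pow_succ _ (k + 1)]
    exact mul_dvd_mul_left _ h1

theorem aux_bound {n : ℕ} (a b : ℝ → (Fin n → ℝ))
    (ha : a =O[𝓝 0] (fun t => t)) (hb : b =O[𝓝 0] (fun t => t))
    (hab : (fun t => a t - b t) =o[𝓝 0] (fun t => t)) (k : ℕ) :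
    ∀ h ∈ idealOfVars (Fin n) ℝ ^ k, (fun t => eval (a t) h) =O[𝓝 0] (fun t => t ^ k) ∧
      (fun t => eval (b t) h) =O[𝓝 0] (fun t => t ^ k) ∧
      (fun t => eval (a t) h - eval (b t) h) =o[𝓝 0] (fun t => t ^ k) := by
  have ta : Tendsto a (𝓝 0) (𝓝 0) := ha.trans_tendsto tendsto_id
  have tb : Tendsto b (𝓝 0) (𝓝 0) := hb.trans_tendsto tendsto_id
  induction k with
  | zero =>
    intro h _
    have c : Continuous (fun y : Fin n → ℝ => eval y h) := MvPolynomial.continuous_eval h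
    have h1 := (c.tendsto 0).comp ta
    have h2 := (c.tendsto 0).comp tb
    simp only [pow_zero]
    refine ⟨h1.isBigO_one ℝ, h2.isBigO_one ℝ, ?_⟩
    rw [isLittleO_one_iff]
    simpa using h1.sub h2
  | succ k ih =>
    intro h hh
    rw [pow_succ'] at hh
    refine Submodule.mul_induction_on hh ?_ ?_
    · intro u hu w hw
      obtain ⟨w1, w2, w3⟩ := ih w hw
      have hu0 : eval (0 : Fin n → ℝ) u = 0 := by
        have : idealOfVars (Fin n) ℝ ≤ RingHom.ker (eval (0 : Fin n → ℝ)) := by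
          rw [idealOfVars, Ideal.span_le]
          rintro _ ⟨j, rfl⟩
          simp
        exact this hu
      have hs := aux_strict u 0
      have u1 : (fun t => eval (a t) u) =O[𝓝 0] (fun t => t) := by
        have := hs.hasFDerivAt.isBigO_sub.comp_tendsto ta
        simp only [hu0, Function.comp_def, sub_zero] at this
        exact this.trans ha
      have u2 : (fun t => eval (b t) u) =O[𝓝 0] (fun t => t) := by
        have := hs.hasFDerivAt.isBigO_sub.comp_tendsto tb
        simp only [hu0, Function.comp_def, sub_zero] at this
        exact this.trans hb
      have u3 : (fun t => eval (a t) u - eval (b t) u) =o[𝓝 0] (fun t => t) := by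
        have := hs.isBigO_sub.comp_tendsto (ta.prodMk_nhds tb)
        exact this.trans_isLittleO hab
      simp only [map_mul, pow_succ']
      refine ⟨u1.mul w1, u2.mul w2, ?_⟩
      have := (u3.mul_isBigO w1).add (u2.mul_isLittleO w3)
      refine this.congr_left (fun t => ?_)
      ring
    · rintro u v ⟨u1, u2, u3⟩ ⟨v1, v2, v3⟩
      simp only [map_add]
      refine ⟨u1.add v1, u2.add v2, ?_⟩
      refine (u3.add v3).congr_left (fun t => ?_)
      ring

theorem aux_mem {n : ℕ} (r : MvPolynomial (Fin n) ℝ) (k : ℕ)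
    (h : ∀ v : Fin n → ℝ, (fun t : ℝ => eval (t • v) r) =o[𝓝 0] (fun t => t ^ k)) :
    r ∈ idealOfVars (Fin n) ℝ ^ (k + 1) := by
  have key : ∀ j < k + 1, homogeneousComponent j r = 0 := by
    intro j hj
    apply MvPolynomial.funext
    intro v
    let Q : Polynomial ℝ := ∑ j ∈ Finset.range (r.totalDegree + 1),
      Polynomial.C (eval v (homogeneousComponent j r)) * Polynomial.X ^ j
    have hQ : ∀ t, Q.eval t = eval (t • v) r := by
      intro t
      conv_rhs => rw [← sum_homogeneousComponent r]
      simp only [Q, Polynomial.eval_finsetSum, map_sum]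
      refine Finset.sum_congr rfl (fun i _ => ?_)
      have hom := homogeneousComponent_isHomogeneous i r
      simp only [Polynomial.eval_mul, Polynomial.eval_pow, Polynomial.eval_X, Polynomial.eval_C]
      rw [eval_eq', eval_eq', Finset.sum_mul]
      refine Finset.sum_congr rfl (fun d hd => ?_)
      have hdeg := hom (mem_support_iff.1 hd)
      simp only [Pi.smul_apply, smul_eq_mul, mul_pow, Finset.prod_mul_distrib]
      rw [Finset.prod_pow_eq_pow_sum]
      have : ∑ j, d j = i := by
        rw [← hdeg, Finsupp.weight_apply, Finsupp.sum_fintype _ _ (by simp)]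
        simp
      rw [this]
      ring
    have hd := aux_univ Q k (by simpa only [hQ] using h v)
    rw [Polynomial.X_pow_dvd_iff] at hd
    have h2 := hd j hj
    simp [Q, Polynomial.coeff_X_pow] at h2
    by_cases hjd : j < r.totalDegree + 1
    · simpa using h2 (by omega)
    · rw [homogeneousComponent_eq_zero _ _ (by omega)]
  rw [mem_pow_idealOfVars_iff']
  intro x hx
  have := congrArg (coeff x) (key _ hx)
  rw [coeff_homogeneousComponent] at this
  simpa using this

theorem aux_real {n m : ℕ} (F : Fin m → MvPolynomial (Fin n) ℝ)
    (A : (Fin n → ℝ) →L[ℝ] (Fin m → ℝ)) (hA : A.range = ⊤)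
    (hF : HasStrictFDerivAt (fun y l => eval y (F l)) A 0)
    (hF0 : ∀ l, eval 0 (F l) = 0)
    (P : MvPolynomial (Fin n) ℝ) (hP : ∀ y, (∀ l, eval y (F l) = 0) → eval y P = 0) (k : ℕ) :
    P ∈ Ideal.span (Set.range F) ⊔ idealOfVars (Fin n) ℝ ^ k := by
  obtain ⟨B, hB⟩ := (A : (Fin n → ℝ) →ₗ[ℝ] (Fin m → ℝ)).exists_rightInverse_of_surjective hA
  have hB' : ∀ y, A (B y) = y := fun y => LinearMap.congr_fun hB y
  let Bc : (Fin m → ℝ) →L[ℝ] (Fin n → ℝ) := LinearMap.toContinuousLinearMap B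
  let G : (Fin n → ℝ) → (Fin m → ℝ) := fun y l => eval y (F l)
  have hG0 : G 0 = 0 := funext hF0
  let g : Fin n → MvPolynomial (Fin n) ℝ := fun j => X j - ∑ l, C (B (Pi.single l 1) j) * F l
  let ψ : MvPolynomial (Fin n) ℝ →ₐ[ℝ] MvPolynomial (Fin n) ℝ := aeval g
  have hg : ∀ y j, eval y (g j) = (y - B (G y)) j := by
    intro y j
    have : B (G y) = ∑ l, G y l • B (Pi.single l 1) := by
      conv_lhs => rw [← Finset.univ_sum_single (G y)]
      rw [map_sum]
      refine Finset.sum_congr rfl fun l _ => ?_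
      rw [← map_smul]
      congr 1
      ext q
      simp [Pi.single_apply]
    rw [this]
    simp [g, G, mul_comm]
  have hψ : ∀ y h, eval y (ψ h) = eval (y - B (G y)) h := by
    intro y h
    have : ((aeval y : MvPolynomial (Fin n) ℝ →ₐ[ℝ] ℝ).comp ψ) = aeval (y - B (G y)) := by
      ext j
      simp only [AlgHom.comp_apply, ψ, aeval_X]
      rw [← hg]
      simp [aeval_eq_eval]
    have := DFunLike.congr_fun this h
    simpa [aeval_eq_eval] using this
  have hJ : ∀ h, h - ψ h ∈ Ideal.span (Set.range F) := by
    intro h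
    have : ((Ideal.Quotient.mkₐ ℝ (Ideal.span (Set.range F))).comp ψ) =
        Ideal.Quotient.mkₐ ℝ (Ideal.span (Set.range F)) := by
      ext j
      simp only [AlgHom.comp_apply, ψ, aeval_X, Ideal.Quotient.mkₐ_eq_mk]
      rw [Ideal.Quotient.eq]
      simp only [g, sub_sub_cancel_left]
      rw [neg_mem_iff]
      exact Ideal.sum_mem _ fun l _ => Ideal.mul_mem_left _ _ (Ideal.subset_span ⟨l, rfl⟩)
    have := DFunLike.congr_fun this h
    simp only [AlgHom.comp_apply, Ideal.Quotient.mkₐ_eq_mk] at this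
    exact Ideal.Quotient.eq.1 this.symm
  induction k with
  | zero => simp
  | succ k ih =>
    obtain ⟨j, hj, h, hh, rfl⟩ := Submodule.mem_sup.1 ih
    have hv : ∀ y, G y = 0 → eval y h = 0 := by
      intro y hy
      have h1 := hP y (fun l => congrFun hy l)
      have h2 : eval y j = 0 := by
        have : Ideal.span (Set.range F) ≤ RingHom.ker (eval y) := by
          rw [Ideal.span_le]
          rintro _ ⟨l, rfl⟩
          exact congrFun hy l
        exact this hj
      simpa [h2] using h1
    have hmem : ψ h ∈ idealOfVars (Fin n) ℝ ^ (k + 1) := by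
      apply aux_mem
      intro v
      simp only [hψ]
      let w : A.ker := ⟨v - B (A v), by simp [hB']⟩
      let b : ℝ → (Fin n → ℝ) := fun t => hF.implicitFunction G A hA (G 0) (t • w)
      let a : ℝ → (Fin n → ℝ) := fun t => t • v - B (G (t • v))
      have hline : ∀ (E : Type) [NormedAddCommGroup E] [NormedSpace ℝ E] (z : E),
          HasDerivAt (fun t : ℝ => t • z) z 0 := by
        intro E _ _ z
        simpa using (hasDerivAt_id (0 : ℝ)).smul_const z
      have hb0 : b 0 = 0 := by
        simp only [b, zero_smul]
        exact hF.implicitFunction_apply_image hA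
      have ha0 : a 0 = 0 := by simp [a, hG0]
      have hb : HasDerivAt b (w : Fin n → ℝ) 0 := by
        have h1 := (hF.to_implicitFunction hA).hasFDerivAt
        have h2 : HasFDerivAt (hF.implicitFunction G A hA (G 0)) A.ker.subtypeL ((0 : ℝ) • w) := by
          rw [zero_smul]; exact h1
        exact h2.comp_hasDerivAt 0 (hline _ w)
      have ha : HasDerivAt a (w : Fin n → ℝ) 0 := by
        have h1 : HasFDerivAt G A ((0 : ℝ) • v) := by rw [zero_smul]; exact hF.hasFDerivAt
        have h2 := h1.comp_hasDerivAt 0 (hline _ v)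
        have h3 := Bc.hasFDerivAt.comp_hasDerivAt 0 h2
        exact (hline _ v).sub h3
      have hbz : ∀ᶠ t in 𝓝 0, eval (b t) h = 0 := by
        have h1 := hF.map_implicitFunction_eq hA
        have h2 : Tendsto (fun t : ℝ => (G 0, t • w)) (𝓝 0) (𝓝 (G 0, 0)) := by
          have : Continuous (fun t : ℝ => (G 0, t • w)) := by fun_prop
          simpa using this.tendsto 0
        filter_upwards [h2.eventually h1] with t ht
        exact hv _ (ht.trans hG0)
      have hab : (fun t => a t - b t) =o[𝓝 0] (fun t : ℝ => t) := by
        have := (ha.sub hb).isLittleO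
        simpa [ha0, hb0] using this
      have Oa : a =O[𝓝 0] (fun t : ℝ => t) := by
        simpa [ha0] using ha.isBigO_sub
      have Ob : b =O[𝓝 0] (fun t : ℝ => t) := by
        simpa [hb0] using hb.isBigO_sub
      have := (aux_bound a b Oa Ob hab k h hh).2.2
      refine this.congr' ?_ EventuallyEq.rfl
      filter_upwards [hbz] with t ht
      rw [ht, sub_zero]
    have : j + h = (j + (h - ψ h)) + ψ h := by ring
    rw [this]
    exact Submodule.add_mem_sup (Ideal.add_mem _ hj (hJ h)) hmem

theorem aux_complex_real {n m : ℕ} (F : Fin m → MvPolynomial (Fin n) ℝ)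
    (A : (Fin n → ℝ) →L[ℝ] (Fin m → ℝ)) (hA : A.range = ⊤)
    (hF : HasStrictFDerivAt (fun y l => eval y (F l)) A 0)
    (hF0 : ∀ l, eval 0 (F l) = 0)
    (I : Ideal (MvPolynomial (Fin n) ℂ)) (hI : I.IsPrime) (hI0 : ∀ q ∈ I, eval 0 q = 0)
    (hFI : ∀ l, MvPolynomial.map Complex.ofRealHom (F l) ∈ I)
    (P : MvPolynomial (Fin n) ℝ) (hP : ∀ y, (∀ l, eval y (F l) = 0) → eval y P = 0) :
    MvPolynomial.map Complex.ofRealHom P ∈ I := by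
  have h1 : ∀ k, MvPolynomial.map Complex.ofRealHom P ∈ I ⊔ idealOfVars (Fin n) ℂ ^ k := by
    intro k
    have h := Ideal.mem_map_of_mem (MvPolynomial.map Complex.ofRealHom) (aux_real F A hA hF hF0 P hP k)
    rw [Ideal.map_sup, Ideal.map_pow] at h
    have hle : ∀ I₁ J₁ I₂ J₂ : Ideal (MvPolynomial (Fin n) ℂ), I₁ ≤ J₁ → I₂ ≤ J₂ →
        I₁ ⊔ I₂ ≤ J₁ ⊔ J₂ := fun _ _ _ _ h1 h2 => sup_le_sup h1 h2
    refine hle _ _ _ _ ?_ (Ideal.pow_right_mono ?_ k) h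
    · rw [Ideal.map_span, Ideal.span_le]
      rintro _ ⟨_, ⟨l, rfl⟩, rfl⟩
      exact hFI l
    · rw [Ideal.map_span, Ideal.span_le]
      rintro _ ⟨_, ⟨l, rfl⟩, rfl⟩
      exact Ideal.subset_span ⟨l, by simp⟩
  have hne : (idealOfVars (Fin n) ℂ).map (Ideal.Quotient.mk I) ≠ ⊤ := by
    intro htop
    have hle : I ⊔ idealOfVars (Fin n) ℂ ≤ RingHom.ker (eval (0 : Fin n → ℂ)) := by
      refine sup_le (fun q hq => hI0 q hq) ?_
      rw [idealOfVars, Ideal.span_le]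
      rintro _ ⟨j, rfl⟩
      simp
    have h2 : (1 : MvPolynomial (Fin n) ℂ) ∈ I ⊔ idealOfVars (Fin n) ℂ := by
      have h3 : Ideal.Quotient.mk I 1 ∈ (idealOfVars (Fin n) ℂ).map (Ideal.Quotient.mk I) := by
        rw [htop]; trivial
      rw [Ideal.mem_map_iff_of_surjective _ Ideal.Quotient.mk_surjective] at h3
      obtain ⟨u, hu, hu2⟩ := h3
      have := Ideal.Quotient.eq.1 hu2.symm
      have e : (1 : MvPolynomial (Fin n) ℂ) = (1 - u) + u := by ring
      rw [e]
      exact Submodule.add_mem_sup this hu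
    have := hle h2
    simp at this
  have hk := Ideal.iInf_pow_eq_bot_of_isDomain _ hne
  have h4 : Ideal.Quotient.mk I (MvPolynomial.map Complex.ofRealHom P) ∈
      ⨅ k : ℕ, ((idealOfVars (Fin n) ℂ).map (Ideal.Quotient.mk I)) ^ k := by
    rw [Submodule.mem_iInf]
    intro k
    obtain ⟨u, hu, v, hv, huv⟩ := Submodule.mem_sup.1 (h1 k)
    rw [← huv, map_add, Ideal.Quotient.eq_zero_iff_mem.2 hu, zero_add, ← Ideal.map_pow]
    exact Ideal.mem_map_of_mem _ hv
  rw [hk] at h4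
  exact Ideal.Quotient.eq_zero_iff_mem.1 h4

theorem aux_split {n : ℕ} (P : MvPolynomial (Fin n) ℂ) :
    ∃ a b : MvPolynomial (Fin n) ℝ,
      P = MvPolynomial.map Complex.ofRealHom a + C Complex.I * MvPolynomial.map Complex.ofRealHom b := by
  induction P using MvPolynomial.induction_on with
  | C z =>
    refine ⟨C z.re, C z.im, ?_⟩
    rw [map_C, map_C, ← C_mul, ← C_add]
    congr 1
    simp [mul_comm Complex.I, Complex.re_add_im]
  | add p q hp hq =>
    obtain ⟨a, b, rfl⟩ := hp
    obtain ⟨c, d, rfl⟩ := hq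
    refine ⟨a + c, b + d, ?_⟩
    simp only [map_add]; ring
  | mul_X p i hp =>
    obtain ⟨a, b, rfl⟩ := hp
    refine ⟨a * X i, b * X i, ?_⟩
    simp only [map_mul, map_X]; ring

theorem aux_eval_ofReal {n : ℕ} (y : Fin n → ℝ) (p : MvPolynomial (Fin n) ℝ) :
    eval (toCPoint y) (MvPolynomial.map Complex.ofRealHom p) = ((eval y p : ℝ) : ℂ) := by
  induction p using MvPolynomial.induction_on with
  | C a => simp
  | add p q hp hq => simp [hp, hq]
  | mul_X p i hp => simp [hp, toCPoint]

theorem aux_aeval_ofReal {n : ℕ} (y : Fin n → ℝ) (p : MvPolynomial (Fin n) ℚ) :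
    aeval (toCPoint y) p = ((aeval y p : ℝ) : ℂ) := by
  induction p using MvPolynomial.induction_on with
  | C a => simp
  | add p q hp hq => simp [hp, hq]
  | mul_X p i hp => simp [hp, toCPoint]

theorem aux_complex {n m : ℕ} (F : Fin m → MvPolynomial (Fin n) ℝ)
    (A : (Fin n → ℝ) →L[ℝ] (Fin m → ℝ)) (hA : A.range = ⊤)
    (hF : HasStrictFDerivAt (fun y l => eval y (F l)) A 0)
    (hF0 : ∀ l, eval 0 (F l) = 0)
    (I : Ideal (MvPolynomial (Fin n) ℂ)) (hI : I.IsPrime) (hI0 : ∀ q ∈ I, eval 0 q = 0)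
    (hFI : ∀ l, MvPolynomial.map Complex.ofRealHom (F l) ∈ I)
    (P : MvPolynomial (Fin n) ℂ)
    (hP : ∀ y : Fin n → ℝ, (∀ l, eval y (F l) = 0) → eval (toCPoint y) P = 0) : P ∈ I := by
  obtain ⟨a, b, rfl⟩ := aux_split P
  have key : ∀ y, (∀ l, eval y (F l) = 0) → eval y a = 0 ∧ eval y b = 0 := by
    intro y hy
    have h := hP y hy
    simp only [map_add, map_mul, eval_C, aux_eval_ofReal] at h
    have h1 := congrArg Complex.re h
    have h2 := congrArg Complex.im h
    simp at h1 h2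
    exact ⟨h1, h2⟩
  refine Ideal.add_mem _ ?_ (Ideal.mul_mem_left _ _ ?_)
  · exact aux_complex_real F A hA hF hF0 I hI hI0 hFI a fun y hy => (key y hy).1
  · exact aux_complex_real F A hA hF hF0 I hI hI0 hFI b fun y hy => (key y hy).2

/-- vanishing ideal of a translate of `C` -/
def aux_vanish {n : ℕ} (D : Set (Fin n → ℂ)) (x : Fin n → ℂ) : Ideal (MvPolynomial (Fin n) ℂ) where
  carrier := {q | ∀ y ∈ D, eval (y - x) q = 0}
  add_mem' := by
    intro a b ha hb y hy
    simp [ha y hy, hb y hy]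
  zero_mem' := by intro y hy; simp
  smul_mem' := by
    intro c a ha y hy
    simp [ha y hy]

noncomputable def aux_tr {R : Type*} [CommRing R] {n : ℕ} (x : Fin n → R) :
    MvPolynomial (Fin n) R →ₐ[R] MvPolynomial (Fin n) R := aeval (fun j => X j + C (x j))

theorem aux_tr_eval {R : Type*} [CommRing R] {n : ℕ} (x y : Fin n → R)
    (p : MvPolynomial (Fin n) R) : eval y (aux_tr x p) = eval (y + x) p := by
  induction p using MvPolynomial.induction_on with
  | C a => simp [aux_tr]
  | add p q hp hq => simp [hp, hq]
  | mul_X p i hp => rw [map_mul, map_mul, hp]; simp [aux_tr]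

theorem aux_vanish_prime {n : ℕ} (D : Set (Fin n → ℂ)) (hD : IsIrreducibleAlgebraicSet D)
    (x : Fin n → ℂ) : (aux_vanish D x).IsPrime := by
  obtain ⟨_, ⟨y0, hy0⟩, h3⟩ := hD
  constructor
  · intro h
    have : (1 : MvPolynomial (Fin n) ℂ) ∈ aux_vanish D x := by rw [h]; trivial
    simpa using this y0 hy0
  · intro a b hab
    have hZ : ∀ q : MvPolynomial (Fin n) ℂ, IsAlgebraicSet {y | eval (y - x) q = 0} := by
      intro q
      refine ⟨{aux_tr (-x) q}, ?_⟩
      ext y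
      simp [aux_tr_eval, sub_eq_add_neg]
    refine h3 {y | eval (y - x) a = 0} {y | eval (y - x) b = 0} (hZ a) (hZ b) ?_
    intro y hy
    have : eval (y - x) (a * b) = 0 := hab y hy
    simpa using this

theorem aux_surj {m n : ℕ} {K : Type*} [Field K] (M : Matrix (Fin m) (Fin n) K) :
    M.rank = m ↔ LinearMap.range M.mulVecLin = ⊤ := by
  rw [Matrix.rank]
  constructor
  · intro h
    apply Submodule.eq_top_of_finrank_eq
    simpa using h
  · intro h
    rw [h]
    simp

theorem aux_rank {n i : ℕ} (hi : i < n) (f : MvPolynomial (Fin n) ℚ) (x : Fin n → ℝ)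
    (h : (jacobianMat n i hi f (toCPoint x)).rank = i + 1) :
    (jacobianMatR n i hi f x).rank = i + 1 := by
  rw [aux_surj, LinearMap.range_eq_top] at h ⊢
  intro y
  obtain ⟨z, hz⟩ := h (toCPoint y)
  refine ⟨fun j => (z j).re, ?_⟩
  ext l
  have := congrArg Complex.re (congrFun hz l)
  simpa [Matrix.mulVec, dotProduct, jacobianMat, jacobianMatR, aux_aeval_ofReal, toCPoint]
    using this

/-- the polynomial system -/
noncomputable def aux_sys (n i : ℕ) (hi : i < n) (f : MvPolynomial (Fin n) ℚ) :
    Fin (i + 1) → MvPolynomial (Fin n) ℚ :=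
  Fin.cons (α := fun _ : Fin (i + 1) => MvPolynomial (Fin n) ℚ) f
        (fun k : Fin i => pderiv (Fin.castLE hi.le k) f)

theorem aux_sys_zero {K : Type*} [Field K] [Algebra ℚ K] (n i : ℕ) (hi : i < n)
    (f : MvPolynomial (Fin n) ℚ) (x : Fin n → K) :
    (∀ l, aeval x (aux_sys n i hi f l) = 0) ↔ (aeval x f = 0 ∧
      ∀ k : Fin i, aeval x (pderiv (Fin.castLE hi.le k) f) = 0) := by
  rw [Fin.forall_fin_succ]
  simp [aux_sys]

theorem aux_sub {n i : ℕ} (hi : i < n) (f : MvPolynomial (Fin n) ℚ) (D : Set (Fin n → ℂ))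
    (hD : IsIrreducibleAlgebraicSet D) (hDz : ∀ y ∈ D, ∀ l, aeval y (aux_sys n i hi f l) = 0)
    (x : Fin n → ℝ) (hx : toCPoint x ∈ D) (hr : (jacobianMatR n i hi f x).rank = i + 1)
    (p : MvPolynomial (Fin n) ℂ)
    (hp : ∀ y : Fin n → ℝ, (∀ l, aeval y (aux_sys n i hi f l) = 0) → eval (toCPoint y) p = 0)
    (z : Fin n → ℂ) (hz : z ∈ D) : eval z p = 0 := by
  let F : Fin (i + 1) → MvPolynomial (Fin n) ℝ := fun l =>
    aux_tr x (MvPolynomial.map (algebraMap ℚ ℝ) (aux_sys n i hi f l))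
  have hFe : ∀ y l, eval y (F l) = aeval (y + x) (aux_sys n i hi f l) := by
    intro y l
    simp only [F, aux_tr_eval]
    rw [eval_map, aeval_def]
  let A : (Fin n → ℝ) →L[ℝ] (Fin (i + 1) → ℝ) :=
    LinearMap.toContinuousLinearMap (jacobianMatR n i hi f x).mulVecLin
  have hA : A.range = ⊤ := (aux_surj _).1 hr
  have hF : HasStrictFDerivAt (fun y l => eval y (F l)) A 0 := by
    rw [hasStrictFDerivAt_pi']
    intro l
    have h1 := aux_strict (MvPolynomial.map (algebraMap ℚ ℝ) (aux_sys n i hi f l)) (0 + x)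
    have h2 : HasStrictFDerivAt (fun y : Fin n → ℝ => y + x) (ContinuousLinearMap.id ℝ _) 0 :=
      (hasStrictFDerivAt_id (0 : Fin n → ℝ)).add_const x
    have h3 := h1.comp (0 : Fin n → ℝ) h2
    have e : (fun y => eval y (F l)) =
        (fun y => eval y (MvPolynomial.map (algebraMap ℚ ℝ) (aux_sys n i hi f l))) ∘ (fun y => y + x) := by
      ext y
      simp [F, aux_tr_eval]
    rw [e]
    refine h3.congr_fderiv ?_
    ext v
    simp [A, Matrix.mulVec, dotProduct, jacobianMatR, pderiv_map, eval_map, aeval_def, aux_sys]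
  have hIp := aux_vanish_prime D hD (toCPoint x)
  have hxx : ∀ l, aeval x (aux_sys n i hi f l) = 0 := by
    intro l
    have := hDz _ hx l
    rw [aux_aeval_ofReal] at this
    exact_mod_cast this
  have hmem : aux_tr (toCPoint x) p ∈ aux_vanish D (toCPoint x) := by
    refine aux_complex F A hA hF ?_ _ hIp ?_ ?_ _ ?_
    · intro l
      rw [hFe, zero_add]
      exact hxx l
    · intro q hq
      simpa using hq _ hx
    · intro l y hy
      have e : ∀ q : MvPolynomial (Fin n) ℚ,
          eval (y - toCPoint x) (MvPolynomial.map Complex.ofRealHom (aux_tr x (MvPolynomial.map (algebraMap ℚ ℝ) q)))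
            = aeval y q := by
        intro q
        induction q using MvPolynomial.induction_on with
        | C a => simp [aux_tr]
        | add p q hp hq => simp only [map_add, hp, hq]
        | mul_X p i hp =>
          simp only [map_mul, hp, map_X]
          simp [aux_tr, toCPoint]
      simp only [F]
      rw [e]
      exact hDz y hy l
    · intro y hy
      rw [aux_tr_eval]
      have e : toCPoint y + toCPoint x = toCPoint (y + x) := by
        ext j; simp [toCPoint]
      rw [e]
      refine hp _ fun l => ?_
      rw [← hFe]
      exact hy l
  have := hmem z hz
  rw [aux_tr_eval, sub_add_cancel] at this
  exact this

/-- the Zariski topology -/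
noncomputable def aux_pt {n : ℕ} (x : Fin n → ℂ) : PrimeSpectrum (MvPolynomial (Fin n) ℂ) :=
  ⟨RingHom.ker (eval x), RingHom.ker_isPrime _⟩

theorem aux_zar (n : ℕ) : ∃ T : TopologicalSpace (Fin n → ℂ),
    @TopologicalSpace.NoetherianSpace _ T ∧ ∀ D, @IsClosed _ T D ↔ IsAlgebraicSet D := by
  let T : TopologicalSpace (Fin n → ℂ) := TopologicalSpace.induced aux_pt inferInstance
  refine ⟨T, Topology.IsInducing.noetherianSpace (i := aux_pt) ⟨rfl⟩, ?_⟩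
  intro D
  rw [isClosed_induced_iff]
  constructor
  · rintro ⟨t, ht, rfl⟩
    obtain ⟨S, rfl⟩ := (PrimeSpectrum.isClosed_iff_zeroLocus t).1 ht
    exact ⟨S, rfl⟩
  · rintro ⟨S, rfl⟩
    exact ⟨_, PrimeSpectrum.isClosed_zeroLocus S, rfl⟩

theorem aux_closed_zc {n : ℕ} (S : Set (Fin n → ℂ)) : IsAlgebraicSet (zariskiClosure S) :=
  ⟨{p | ∀ y ∈ S, eval y p = 0}, rfl⟩

theorem aux_zc_min {n : ℕ} (S D : Set (Fin n → ℂ)) (hD : IsAlgebraicSet D) (h : S ⊆ D) :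
    zariskiClosure S ⊆ D := by
  obtain ⟨T, rfl⟩ := hD
  intro x hx p hp
  exact hx p fun y hy => h hy p hp

theorem aux_cover {n : ℕ} (W V : Set (Fin n → ℂ)) (hW : IsAlgebraicSet W) (hVW : V ⊆ W) :
    ∀ z ∈ zariskiClosure V, ∃ D, IsIrreducibleComponentOf D W ∧ z ∈ D ∧ (D ∩ V).Nonempty := by
  obtain ⟨T, hT, hcl⟩ := aux_zar n
  have hirr : ∀ D : Set (Fin n → ℂ), IsClosed D → (IsIrreducible D ↔ IsIrreducibleAlgebraicSet D) := by
    intro D hD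
    rw [IsIrreducible, isPreirreducible_iff_isClosed_union_isClosed]
    simp only [hcl, IsIrreducibleAlgebraicSet]
    rw [hcl] at hD
    tauto
  obtain ⟨S, hSf, hSc, hSi, hWS⟩ :=
    TopologicalSpace.NoetherianSpace.exists_finite_set_isClosed_irreducible ((hcl W).2 hW)
  have hmax : ∀ D, Maximal (· ∈ S) D → IsIrreducibleComponentOf D W := by
    intro D hD
    refine ⟨(hirr D (hSc D hD.1)).1 (hSi D hD.1), ?_, ?_⟩
    · rw [hWS]; exact Set.subset_sUnion_of_mem hD.1
    · intro D' hD' hD'W hDD'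
      have h1 := (hirr D' ((hcl _).2 hD'.1)).2 hD'
      obtain ⟨E, hE, hE2⟩ := isIrreducible_iff_sUnion_isClosed.1 h1 hSf.toFinset
        (fun z hz => hSc z (by simpa using hz)) (by simpa [← hWS] using hD'W)
      have hE' : E ∈ S := by simpa using hE
      exact (hE2.trans (hD.2 hE' (hDD'.trans hE2))).antisymm hDD'
  let G : Set (Set (Fin n → ℂ)) := {D ∈ S | Maximal (· ∈ S) D ∧ (D ∩ V).Nonempty}
  have hGc : IsClosed (⋃₀ G) := by
    rw [Set.sUnion_eq_biUnion]
    exact (hSf.subset (Set.sep_subset _ _)).isClosed_biUnion fun D hD => hSc D hD.1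
  have hVG : V ⊆ ⋃₀ G := by
    intro v hv
    have := hVW hv
    rw [hWS] at this
    obtain ⟨D, hD, hvD⟩ := this
    obtain ⟨E, hDE, hE⟩ := hSf.exists_le_maximal hD
    exact ⟨E, ⟨hE.1, hE, v, hDE hvD, hv⟩, hDE hvD⟩
  intro z hz
  obtain ⟨D, hD, hzD⟩ := aux_zc_min V _ ((hcl _).1 hGc) hVG hz
  exact ⟨D, hmax D hD.2.1, hzD, hD.2.2⟩

end AuxLemmas

theorem statement5 (n i : ℕ) (hi : i < n) (f : MvPolynomial (Fin n) ℚ)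
    (hnc : f.totalDegree ≠ 0) (hsf : Squarefree f)
    -- `V = {x ∈ ℝⁿ : f(x) = 0}` is non-empty and bounded
    (hVne : {x : Fin n → ℝ | aeval x f = 0}.Nonempty)
    (hbdd : Bornology.IsBounded {x : Fin n → ℝ | aeval x f = 0})
    -- the gradient of `f` never vanishes on `V`
    (hgrad : ∀ x : Fin n → ℝ, aeval x f = 0 → ∃ j : Fin n, aeval x (pderiv j f) ≠ 0)
    -- `Vᵢ` is non-empty
    (hVine : {x : Fin n → ℝ | aeval x f = 0 ∧
      ∀ k : Fin i, aeval x (pderiv (Fin.castLE hi.le k) f) = 0}.Nonempty)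
    -- at every point of `W̃ᵢ` with `Δ(x) ≠ 0` the Jacobian has maximal rank `i + 1`
    (hjac : ∀ x ∈ polarCore n i hi f, (jacobianMat n i hi f x).rank = i + 1) :
    -- the real part `Wᵢ*` of `Wᵢ` coincides with the Zariski closure of `Vᵢ`
    ⋃₀ {C : Set (Fin n → ℂ) |
        IsIrreducibleComponentOf C (zariskiClosure (polarCore n i hi f)) ∧
          ∃ x : Fin n → ℝ, toCPoint x ∈ C ∧ (jacobianMatR n i hi f x).rank = i + 1}
      = zariskiClosure (toCPoint '' {x : Fin n → ℝ | aeval x f = 0 ∧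
          ∀ k : Fin i, aeval x (pderiv (Fin.castLE hi.le k) f) = 0}) := by
  have hW : ∀ y ∈ zariskiClosure (polarCore n i hi f), ∀ l, aeval y (aux_sys n i hi f l) = 0 := by
    intro y hy l
    have h := hy (map (algebraMap ℚ ℂ) (aux_sys n i hi f l)) (by
      intro w hw
      rw [eval_map, ← aeval_def]
      exact (aux_sys_zero n i hi f w).2 ⟨hw.1, hw.2.1⟩ l)
    rwa [eval_map, ← aeval_def] at h
  have hVcore : toCPoint '' {x : Fin n → ℝ | aeval x f = 0 ∧
      ∀ k : Fin i, aeval x (pderiv (Fin.castLE hi.le k) f) = 0} ⊆ polarCore n i hi f := by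
    rintro _ ⟨x, ⟨hx0, hx1⟩, rfl⟩
    refine ⟨?_, ?_, ?_⟩
    · rw [aux_aeval_ofReal, hx0]; simp
    · intro k
      rw [aux_aeval_ofReal, hx1 k]; simp
    · rw [aux_aeval_ofReal]
      obtain ⟨j, hj⟩ := hgrad x hx0
      have h1 : 0 < aeval x (∑ j : Fin n, (pderiv j f) ^ 2) := by
        rw [map_sum]
        refine Finset.sum_pos' (fun k _ => ?_) ⟨j, Finset.mem_univ _, ?_⟩
        · rw [map_pow]; positivity
        · rw [map_pow]; positivity
      exact_mod_cast h1.ne'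
  have hcoreW : polarCore n i hi f ⊆ zariskiClosure (polarCore n i hi f) :=
    fun y hy p hp => hp y hy
  apply Set.Subset.antisymm
  · rintro z ⟨D, ⟨hD, x, hxD, hr⟩, hzD⟩ p hp
    refine aux_sub hi f D hD.1 (fun y hy => hW y (hD.2.1 hy)) x hxD hr p ?_ z hzD
    intro y hy
    exact hp _ ⟨y, (aux_sys_zero n i hi f y).1 hy, rfl⟩
  · intro z hz
    obtain ⟨D, hD, hzD, _, hvD, ⟨x, hx, rfl⟩⟩ := aux_cover (zariskiClosure (polarCore n i hi f)) _
      (aux_closed_zc _) (hVcore.trans hcoreW) z hz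
    exact ⟨D, ⟨hD, x, hvD, aux_rank hi f x (hjac _ (hVcore ⟨x, hx, rfl⟩))⟩, hzD⟩
end

section
/- Fix 0 ≤ i < n. Let f ∈ ℚ[X₁,…,Xₙ] be a non-constant square-free polynomial, W = {x ∈ ℂⁿ : f(x) = 0}, V = W ∩ ℝⁿ, Δ = Σ_{j=1}ⁿ (∂ⱼf)², W̃ᵢ = {x ∈ ℂⁿ : f(x) = ∂₁f(x) = ⋯ = ∂ᵢf(x) = 0}, Wᵢ the Zariski closure in ℂⁿ of W̃ᵢ ∖ {Δ = 0}, and Vᵢ = {x ∈ ℝⁿ : f(x) = ∂₁f(x) = ⋯ = ∂ᵢf(x) = 0}. Assume that the gradient of f is nonzero at every point of V. Then Wᵢ ∩ ℝⁿ = Vᵢ, and the inclusions Vᵢ ⊆ V, Vᵢ ⊆ Wᵢ ⊆ W̃ᵢ ⊆ W hold. -/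
open MvPolynomial

theorem toC_aeval {n : ℕ} (x : Fin n → ℝ) (p : MvPolynomial (Fin n) ℚ) :
    aeval (toCPoint x) p = ((aeval x p : ℝ) : ℂ) := by
  have h := MvPolynomial.aeval_algebraMap_apply (A := ℝ) ℂ x p
  exact h

theorem zc_aeval {n : ℕ} {S : Set (Fin n → ℂ)} {x : Fin n → ℂ} (hx : x ∈ zariskiClosure S)
    (p : MvPolynomial (Fin n) ℚ) (h : ∀ y ∈ S, aeval y p = 0) : aeval x p = 0 := by
  have h2 : ∀ y : Fin n → ℂ, eval y (map (algebraMap ℚ ℂ) p) = aeval y p := by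
    intro y
    rw [eval_map, aeval_def]
  rw [← h2]
  apply hx
  intro y hy
  rw [h2]
  exact h y hy

theorem sub_zc {n : ℕ} {S : Set (Fin n → ℂ)} : S ⊆ zariskiClosure S :=
  fun x hx _ hp => hp x hx

theorem statement6 (n i : ℕ) (hi : i < n) (f : MvPolynomial (Fin n) ℚ)
    (hnc : f.totalDegree ≠ 0) (hsf : Squarefree f)
    -- the gradient of `f` is nonzero at every point of `V = W ∩ ℝⁿ`
    (hgrad : ∀ x : Fin n → ℝ, aeval x f = 0 → ∃ j : Fin n, aeval x (pderiv j f) ≠ 0) :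
    -- `Wᵢ ∩ ℝⁿ = Vᵢ`
    zariskiClosure {x : Fin n → ℂ | aeval x f = 0 ∧
        (∀ k : Fin i, aeval x (pderiv (Fin.castLE hi.le k) f) = 0) ∧
        aeval x (∑ j : Fin n, (pderiv j f) ^ 2) ≠ 0}
      ∩ Set.range (toCPoint (n := n))
      = toCPoint '' {x : Fin n → ℝ | aeval x f = 0 ∧
          ∀ k : Fin i, aeval x (pderiv (Fin.castLE hi.le k) f) = 0} ∧
    -- `Vᵢ ⊆ V`
    {x : Fin n → ℝ | aeval x f = 0 ∧
        ∀ k : Fin i, aeval x (pderiv (Fin.castLE hi.le k) f) = 0}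
      ⊆ {x : Fin n → ℝ | aeval x f = 0} ∧
    -- `Vᵢ ⊆ Wᵢ` (via the inclusion `ℝⁿ → ℂⁿ`)
    toCPoint '' {x : Fin n → ℝ | aeval x f = 0 ∧
        ∀ k : Fin i, aeval x (pderiv (Fin.castLE hi.le k) f) = 0}
      ⊆ zariskiClosure {x : Fin n → ℂ | aeval x f = 0 ∧
          (∀ k : Fin i, aeval x (pderiv (Fin.castLE hi.le k) f) = 0) ∧
          aeval x (∑ j : Fin n, (pderiv j f) ^ 2) ≠ 0} ∧
    -- `Wᵢ ⊆ W̃ᵢ`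
    zariskiClosure {x : Fin n → ℂ | aeval x f = 0 ∧
        (∀ k : Fin i, aeval x (pderiv (Fin.castLE hi.le k) f) = 0) ∧
        aeval x (∑ j : Fin n, (pderiv j f) ^ 2) ≠ 0}
      ⊆ {x : Fin n → ℂ | aeval x f = 0 ∧
          ∀ k : Fin i, aeval x (pderiv (Fin.castLE hi.le k) f) = 0} ∧
    -- `W̃ᵢ ⊆ W`
    {x : Fin n → ℂ | aeval x f = 0 ∧
        ∀ k : Fin i, aeval x (pderiv (Fin.castLE hi.le k) f) = 0}
      ⊆ {x : Fin n → ℂ | aeval x f = 0} := by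
  have hVW : toCPoint '' {x : Fin n → ℝ | aeval x f = 0 ∧
        ∀ k : Fin i, aeval x (pderiv (Fin.castLE hi.le k) f) = 0}
      ⊆ zariskiClosure {x : Fin n → ℂ | aeval x f = 0 ∧
          (∀ k : Fin i, aeval x (pderiv (Fin.castLE hi.le k) f) = 0) ∧
          aeval x (∑ j : Fin n, (pderiv j f) ^ 2) ≠ 0} := by
    rintro _ ⟨x, ⟨h0, hk⟩, rfl⟩
    apply sub_zc
    refine ⟨by rw [toC_aeval, h0]; simp, fun k => by rw [toC_aeval, hk]; simp, ?_⟩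
    rw [toC_aeval, Complex.ofReal_ne_zero]
    obtain ⟨j, hj⟩ := hgrad x h0
    simp only [map_sum, map_pow]
    apply ne_of_gt
    exact Finset.sum_pos' (fun _ _ => sq_nonneg _) ⟨j, Finset.mem_univ _, by positivity⟩
  have hWW : zariskiClosure {x : Fin n → ℂ | aeval x f = 0 ∧
        (∀ k : Fin i, aeval x (pderiv (Fin.castLE hi.le k) f) = 0) ∧
        aeval x (∑ j : Fin n, (pderiv j f) ^ 2) ≠ 0}
      ⊆ {x : Fin n → ℂ | aeval x f = 0 ∧
          ∀ k : Fin i, aeval x (pderiv (Fin.castLE hi.le k) f) = 0} := by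
    intro x hx
    exact ⟨zc_aeval hx _ fun y hy => hy.1, fun k => zc_aeval hx _ fun y hy => hy.2.1 k⟩
  refine ⟨?_, fun x hx => hx.1, hVW, hWW, fun x hx => hx.1⟩
  apply Set.Subset.antisymm
  · rintro _ ⟨hx, x, rfl⟩
    obtain ⟨h0, hk⟩ := hWW hx
    refine ⟨x, ⟨?_, fun k => ?_⟩, rfl⟩
    · rw [toC_aeval] at h0
      exact_mod_cast h0
    · have := hk k
      rw [toC_aeval] at this
      exact_mod_cast this
  · intro y hy
    refine ⟨hVW hy, ?_⟩
    obtain ⟨x, _, rfl⟩ := hy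
    exact ⟨x, rfl⟩
end

section
/- Fix 0 ≤ i < n and an index j with i < j ≤ n. Let f ∈ ℚ[X₁,…,Xₙ] be a non-constant square-free polynomial. Assume that at every point x ∈ ℂⁿ with f(x) = ∂₁f(x) = ⋯ = ∂ᵢf(x) = 0 and ∂ⱼf(x) ≠ 0, the Jacobian matrix of the system (f, ∂₁f, …, ∂ᵢf) at x has maximal rank i+1 (as holds when the variables are in generic position). Then the ideal generated by f, ∂₁f, …, ∂ᵢf in the localization of ℚ[X₁,…,Xₙ] at the multiplicative set of powers of ∂ⱼf is a radical ideal. -/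
open MvPolynomial

open TensorProduct in
theorem aux_etale_reduced (R S : Type) [CommRing R] [IsDomain R] [CommRing S] [Algebra R S]
    [Algebra.Etale R S] : IsReduced S := by
  have : Module.Flat R S := inferInstance
  have : IsReduced (FractionRing R ⊗[R] S) :=
    Algebra.FormallyUnramified.isReduced_of_field (FractionRing R) _
  have hinj : Function.Injective
      (Algebra.TensorProduct.includeRight : S →ₐ[R] FractionRing R ⊗[R] S) :=
    Algebra.TensorProduct.includeRight_injective (IsFractionRing.injective R (FractionRing R))
  exact isReduced_of_injective _ hinj

theorem aux_smooth_reduced (k S : Type) [Field k] [CommRing S] [Algebra k S] [Nontrivial S]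
    {ι σ : Type} [Finite ι] [Finite σ]
    (P : Algebra.SubmersivePresentation k S ι σ) : IsReduced S := by
  have := P.isStandardSmoothOfRelativeDimension rfl
  obtain ⟨g, hg⟩ :=
    Algebra.IsStandardSmoothOfRelativeDimension.exists_etale_mvPolynomial k S (n := P.dimension)
  algebraize [g.toRingHom]
  have : Algebra.Etale (MvPolynomial (Fin P.dimension) k) S := hg
  exact aux_etale_reduced (MvPolynomial (Fin P.dimension) k) S

theorem aux_loc (n m : ℕ) (v : Fin m → MvPolynomial (Fin n) ℚ) (c : Fin m → Fin n)
    (hc : Function.Injective c) (p : MvPolynomial (Fin n) ℚ)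
    (k : ℕ) (hp : p ^ k ∈ Ideal.span (Set.range v)) :
    ∃ M : ℕ, (Matrix.of fun i j => pderiv (c i) (v j)).det ^ M * p
      ∈ Ideal.span (Set.range v) := by
  classical
  let P := Algebra.PreSubmersivePresentation.naive (v := v) c hc
  let B := MvPolynomial (Fin n) ℚ ⧸ Ideal.span (Set.range v)
  have hjac : P.jacobian = Ideal.Quotient.mk (Ideal.span (Set.range v))
      (Matrix.of fun i j => pderiv (c i) (v j)).det := by
    rw [P.jacobian_eq_jacobiMatrix_det]
    have : P.jacobiMatrix = Matrix.of fun i j => pderiv (c i) (v j) := by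
      ext1 i j
      rw [P.jacobiMatrix_apply]; rfl
    rw [this]
    rfl
  have hred : IsReduced (Localization.Away (P.jacobian : B)) := by
    cases subsingleton_or_nontrivial (Localization.Away (P.jacobian : B))
    · infer_instance
    let Q := Algebra.SubmersivePresentation.localizationAway
      (Localization.Away (P.jacobian : B)) (P.jacobian : B)
    let T : Algebra.SubmersivePresentation ℚ (Localization.Away (P.jacobian : B)) _ _ :=
      { Q.toPreSubmersivePresentation.comp P with
        jacobian_isUnit := by
          have := Algebra.PreSubmersivePresentation.comp_jacobian_eq_jacobian_smul_jacobian
            Q.toPreSubmersivePresentation P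
          refine (this ▸ ?_ : IsUnit (Q.toPreSubmersivePresentation.comp P).jacobian)
          rw [Algebra.smul_def, IsUnit.mul_iff]
          exact ⟨IsLocalization.Away.algebraMap_isUnit _, Q.jacobian_isUnit⟩ }
    exact aux_smooth_reduced ℚ _ T
  have h0 : algebraMap B (Localization.Away (P.jacobian : B))
      (Ideal.Quotient.mk _ p) = 0 := by
    refine hred.eq_zero _ ⟨k, ?_⟩
    rw [← map_pow, ← map_pow, Ideal.Quotient.eq_zero_iff_mem.2 hp, map_zero]
  rw [IsLocalization.map_eq_zero_iff (Submonoid.powers (P.jacobian : B))] at h0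
  obtain ⟨⟨_, M, rfl⟩, h⟩ := h0
  refine ⟨M, Ideal.Quotient.eq_zero_iff_mem.1 ?_⟩
  rw [map_mul, map_pow, ← hjac]
  exact h

theorem aux_minor (m n : ℕ) (A : Matrix (Fin m) (Fin n) ℂ) (h : A.rank = m) :
    ∃ c : Fin m → Fin n, Function.Injective c ∧ (A.submatrix id c).det ≠ 0 := by
  obtain ⟨κ, a, ha, hsp, hli⟩ := exists_linearIndependent' ℂ A.col
  have : Finite κ := Finite.of_injective a ha
  have := Fintype.ofFinite κ
  have hcard : Fintype.card κ = m := by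
    rw [← h, A.rank_eq_finrank_span_cols, ← hsp, finrank_span_eq_card hli]
  let e : Fin m ≃ κ := (Fintype.equivFinOfCardEq hcard).symm
  refine ⟨a ∘ e, ha.comp e.injective, ?_⟩
  have h2 : LinearIndependent ℂ (A.submatrix id (a ∘ e)).col :=
    hli.comp e e.injective
  rw [Matrix.linearIndependent_cols_iff_isUnit, Matrix.isUnit_iff_isUnit_det] at h2
  exact h2.ne_zero

theorem aux_main (n m : ℕ) (v : Fin m → MvPolynomial (Fin n) ℚ) (g : MvPolynomial (Fin n) ℚ)
    (hjac : ∀ x : Fin n → ℂ, (∀ l, aeval x (v l) = 0) → aeval x g ≠ 0 →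
      (Matrix.of fun l k => aeval x (pderiv k (v l)) : Matrix (Fin m) (Fin n) ℂ).rank = m) :
    (Ideal.span (algebraMap (MvPolynomial (Fin n) ℚ) (Localization.Away g) ''
      Set.range v)).IsRadical := by
  classical
  rw [← Ideal.map_span]
  set I := Ideal.span (Set.range v) with hI
  have key : ∀ p : MvPolynomial (Fin n) ℚ,
      algebraMap _ (Localization.Away g) p ∈ I.map (algebraMap _ (Localization.Away g)) ↔
      ∃ N : ℕ, g ^ N * p ∈ I := by
    intro p
    rw [IsLocalization.algebraMap_mem_map_algebraMap_iff (Submonoid.powers g)]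
    constructor
    · rintro ⟨_, ⟨N, rfl⟩, h⟩
      exact ⟨N, h⟩
    · rintro ⟨N, h⟩
      exact ⟨_, ⟨N, rfl⟩, h⟩
  rintro a ⟨k, hk⟩
  obtain ⟨p, ⟨_, M, rfl⟩, rfl⟩ := IsLocalization.exists_mk'_eq (Submonoid.powers g) a
  rw [IsLocalization.mk'_mem_iff]
  have hk' : algebraMap _ (Localization.Away g) (p ^ k) ∈
      I.map (algebraMap _ (Localization.Away g)) := by
    rwa [← IsLocalization.mk'_pow, IsLocalization.mk'_mem_iff] at hk
  obtain ⟨N, hN⟩ := (key _).1 hk'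
  have hgp : (g ^ N * p) ^ (k + 1) ∈ I := by
    have : (g ^ N * p) ^ (k + 1) = (g ^ N * p ^ k) * (g ^ (N * k) * p) := by ring
    rw [this]
    exact I.mul_mem_right _ hN
  -- the ideal of multipliers
  let J : Ideal (MvPolynomial (Fin n) ℚ) :=
    { carrier := {q | ∃ L : ℕ, g ^ L * (q * p) ∈ I}
      zero_mem' := ⟨0, by simp⟩
      add_mem' := by
        rintro q r ⟨L, hL⟩ ⟨K, hK⟩
        refine ⟨L + K, ?_⟩
        have : g ^ (L + K) * ((q + r) * p)
          = g ^ K * (g ^ L * (q * p)) + g ^ L * (g ^ K * (r * p)) := by ring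
        rw [this]
        exact I.add_mem (I.mul_mem_left _ hL) (I.mul_mem_left _ hK)
      smul_mem' := by
        rintro r q ⟨L, hL⟩
        refine ⟨L, ?_⟩
        have : g ^ L * ((r • q) * p) = r * (g ^ L * (q * p)) := by
          rw [smul_eq_mul]; ring
        rw [this]
        exact I.mul_mem_left _ hL }
  have hg : g ∈ J.radical := by
    rw [← vanishingIdeal_zeroLocus_eq_radical (K := ℂ), mem_vanishingIdeal_iff]
    intro x hx
    by_contra hgx
    rw [mem_zeroLocus_iff] at hx
    have hv : ∀ l, aeval x (v l) = 0 := fun l => hx _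
      ⟨0, by
        rw [pow_zero, one_mul]
        exact I.mul_mem_right _ (Ideal.subset_span ⟨l, rfl⟩)⟩
    obtain ⟨c, hc, hdet⟩ := aux_minor _ _ _ (hjac x hv hgx)
    obtain ⟨M, hM⟩ := aux_loc n m v c hc _ _ hgp
    have h1 := hx ((Matrix.of fun i j => pderiv (c i) (v j)).det ^ M) ⟨N, by
      convert hM using 1; ring⟩
    rw [map_pow] at h1
    have h2 := eq_zero_of_pow_eq_zero h1
    apply hdet
    rw [← Matrix.det_transpose, ← h2, AlgHom.map_det]
    rfl
  obtain ⟨L, K, hK⟩ := hg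
  refine (key p).2 ⟨K + L, ?_⟩
  convert hK using 1; ring

theorem statement7 (n i : ℕ) (hi : i < n) (j : Fin n) (hj : i ≤ (j : ℕ))
    (f : MvPolynomial (Fin n) ℚ) (hnc : f.totalDegree ≠ 0) (hsf : Squarefree f)
    -- at every point with `f = ∂₁f = ⋯ = ∂ᵢf = 0` and `∂ⱼf ≠ 0`, the Jacobian of
    -- `(f, ∂₁f, …, ∂ᵢf)` has maximal rank `i + 1`
    (hjac : ∀ x : Fin n → ℂ, aeval x f = 0 →
      (∀ k : Fin i, aeval x (pderiv (Fin.castLE hi.le k) f) = 0) →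
      aeval x (pderiv j f) ≠ 0 → (jacobianMat n i hi f x).rank = i + 1) :
    -- the ideal `(f, ∂₁f, …, ∂ᵢf)` in `ℚ[X₁,…,Xₙ]_{∂ⱼf}` is radical
    (Ideal.span
        (algebraMap (MvPolynomial (Fin n) ℚ) (Localization.Away (pderiv j f)) ''
          Set.range (Fin.cons (α := fun _ : Fin (i + 1) => MvPolynomial (Fin n) ℚ) f
            (fun k : Fin i => pderiv (Fin.castLE hi.le k) f)))).IsRadical := by
  refine aux_main n (i + 1) _ _ ?_
  intro x hx hg
  exact hjac x (hx 0) (fun k => hx k.succ) hg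
end

section
/- Fix 0 ≤ i < n. Let f ∈ ℚ[X₁,…,Xₙ] be a non-constant square-free polynomial and Δ = Σ_{j=1}ⁿ (∂ⱼf)². Assume that at every point x ∈ ℂⁿ with f(x) = ∂₁f(x) = ⋯ = ∂ᵢf(x) = 0 and Δ(x) ≠ 0, the Jacobian matrix of the system (f, ∂₁f, …, ∂ᵢf) at x has maximal rank i+1 (as holds when the variables are in generic position). Then the ideal generated by f, ∂₁f, …, ∂ᵢf in the localization of ℚ[X₁,…,Xₙ] at the multiplicative set of powers of Δ is a radical ideal. -/
open MvPolynomial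

theorem etale_red (P S : Type) [CommRing P] [IsDomain P] [CommRing S] [Algebra P S]
    [Algebra.Etale P S] : IsReduced S := by
  have hflat : Module.Flat P S := Algebra.Smooth.flat P S
  let K := FractionRing P
  have hred : IsReduced (TensorProduct P K S) :=
    Algebra.FormallyUnramified.isReduced_of_field K (TensorProduct P K S)
  have hinj : Function.Injective
      (Algebra.TensorProduct.includeRight : S →ₐ[P] TensorProduct P K S) :=
    Algebra.TensorProduct.includeRight_injective (IsFractionRing.injective P K)
  exact isReduced_of_injective _ hinj

theorem smooth_red (S : Type) [CommRing S] [Algebra ℚ S] [Algebra.Smooth ℚ S] :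
    IsReduced S := by
  constructor
  intro x hx
  by_contra hne
  let I : Ideal S := LinearMap.ker (LinearMap.toSpanSingleton S S x)
  have hItop : I ≠ ⊤ := by
    intro h
    have : (1 : S) ∈ I := h ▸ Submodule.mem_top
    exact hne (by simpa [I] using this)
  obtain ⟨m, hm, hle⟩ := Ideal.exists_le_maximal I hItop
  obtain ⟨f, hf, n, _, _, _⟩ :=
    Algebra.IsSmoothAt.exists_isStandardEtale_mvPolynomial (R := ℚ) (p := m)
  have hred : IsReduced (Localization.Away f) :=
    etale_red (MvPolynomial (Fin n) ℚ) (Localization.Away f)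
  have h0 : algebraMap S (Localization.Away f) x = 0 := (hx.map _).eq_zero
  rw [IsLocalization.map_eq_zero_iff (Submonoid.powers f)] at h0
  obtain ⟨⟨_, k, rfl⟩, hk⟩ := h0
  have : f ^ k ∈ m := hle (by simpa [I] using hk)
  exact hf (hm.isPrime.mem_of_pow_mem _ this)

theorem taylor1 {n : ℕ} {B : Type} [CommRing B] [Algebra ℚ B] (J : Ideal B) (hJ : J ^ 2 = ⊥)
    (x e : Fin n → B) (he : ∀ j, e j ∈ J) (p : MvPolynomial (Fin n) ℚ) :
    aeval (x + e) p = aeval x p + ∑ j, aeval x (pderiv j p) * e j := by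
  have h2 : ∀ a ∈ J, ∀ b ∈ J, a * b = 0 := by
    intro a ha b hb
    have : a * b ∈ J ^ 2 := by rw [pow_two]; exact Ideal.mul_mem_mul ha hb
    simpa [hJ] using this
  induction p using MvPolynomial.induction_on with
  | C a => simp
  | add p q hp hq => simp [hp, hq, add_mul, Finset.sum_add_distrib]; ring
  | mul_X p i hp =>
    have h3 : (∑ j, aeval x (pderiv j p) * e j) * e i = 0 :=
      h2 _ (J.sum_mem fun j _ => J.mul_mem_left _ (he j)) _ (he i)
    have h4 : ∑ j, aeval x (pderiv j (p * X i)) * e j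
        = (∑ j, aeval x (pderiv j p) * e j) * x i + aeval x p * e i := by
      simp only [Derivation.leibniz, pderiv_X, smul_eq_mul, map_add, map_mul, aeval_X, add_mul,
        Finset.sum_add_distrib]
      rw [add_comm]
      congr 1
      · rw [Finset.sum_mul]; exact Finset.sum_congr rfl fun j _ => by ring
      · rw [Finset.sum_eq_single i]
        · simp
        · intro j _ hj; simp [hj.symm]
        · simp
    rw [h4]
    simp only [map_mul, aeval_X, hp, Pi.add_apply]
    linear_combination h3

theorem surj_of_max {S : Type} [CommRing S] {m n : ℕ} (G : Matrix (Fin m) (Fin n) S)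
    (h : ∀ M : Ideal S, M.IsMaximal → ∀ w : Fin m → S ⧸ M, ∃ v,
      (G.map (Ideal.Quotient.mk M)).mulVec v = w) : ∃ B : Matrix (Fin n) (Fin m) S, G * B = 1 := by
  rw [← Matrix.mulVec_surjective_iff_exists_right_inverse]
  let N := LinearMap.range G.mulVecLin
  suffices hN : N = ⊤ by
    have := LinearMap.range_eq_top.1 hN
    exact this
  let I : Ideal S := Module.annihilator S ((Fin m → S) ⧸ N)
  suffices hI : I = ⊤ by
    have h1 : (1 : S) ∈ I := hI ▸ Submodule.mem_top
    rw [Module.mem_annihilator] at h1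
    rw [eq_top_iff]
    intro v _
    have := h1 (Submodule.Quotient.mk v)
    rwa [one_smul, Submodule.Quotient.mk_eq_zero] at this
  by_contra hne
  obtain ⟨M, hM, hle⟩ := Ideal.exists_le_maximal I hne
  obtain ⟨r, hr, hr2⟩ := Submodule.exists_sub_one_mem_and_smul_eq_zero_of_fg_of_le_smul M
    (⊤ : Submodule S ((Fin m → S) ⧸ N)) (Module.Finite.fg_top) (by
      rintro q -
      obtain ⟨w, rfl⟩ := Submodule.Quotient.mk_surjective _ q
      obtain ⟨v, hv⟩ := h M hM (fun l => Ideal.Quotient.mk M (w l))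
      choose v' hv' using fun j => Ideal.Quotient.mk_surjective (v j)
      have e : (Submodule.Quotient.mk w : (Fin m → S) ⧸ N)
          = ∑ l, (w l - G.mulVec v' l) • Submodule.Quotient.mk (Pi.single l (1 : S)) := by
        have : Submodule.Quotient.mk w = (Submodule.Quotient.mk (w - G.mulVec v') :
            (Fin m → S) ⧸ N) := by
          rw [Submodule.Quotient.eq]
          exact ⟨v', by simp⟩
        rw [this]
        conv_lhs => rw [pi_eq_sum_univ' (w - G.mulVec v')]
        rw [← Submodule.mkQ_apply, map_sum]
        refine Finset.sum_congr rfl fun l _ => ?_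
        rw [map_smul]; rfl
      rw [e]
      refine Submodule.sum_mem _ fun l _ => Submodule.smul_mem_smul ?_ trivial
      rw [← Ideal.Quotient.eq_zero_iff_mem, map_sub, sub_eq_zero]
      have := congrFun hv l
      simp only [Matrix.mulVec, dotProduct, Matrix.map_apply, ← hv'] at this
      rw [← this]
      simp [Matrix.mulVec, dotProduct])
  have hrI : r ∈ I := Module.mem_annihilator.2 fun q => hr2 q trivial
  have : (1 : S) ∈ M := by
    have := M.sub_mem (hle hrI) hr
    simpa using this
  exact hM.ne_top ((Ideal.eq_top_iff_one _).2 this)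

theorem surj_desc {K : Type} [Field K] (ψ : K →+* ℂ) {m n : ℕ} (G : Matrix (Fin m) (Fin n) K)
    (h : (G.map ψ).rank = m) (w : Fin m → K) : ∃ v, G.mulVec v = w := by
  have surj : ∀ {F : Type} [Field F] (H : Matrix (Fin m) (Fin n) F), H.rank = m →
      Function.Surjective H.mulVec := by
    intro F _ H hH
    have : LinearMap.range H.mulVecLin = ⊤ := by
      apply Submodule.eq_top_of_finrank_eq
      rw [← Matrix.rank, hH]; simp
    exact LinearMap.range_eq_top.1 this
  obtain ⟨B, hB⟩ := Matrix.mulVec_surjective_iff_exists_right_inverse.1 (surj _ h)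
  have hli : LinearIndependent K G.row := by
    rw [← Matrix.vecMul_injective_iff]
    rw [← Matrix.coe_vecMulLinear, ← LinearMap.ker_eq_bot, LinearMap.ker_eq_bot']
    intro w hw
    have h1 : Matrix.vecMul (ψ ∘ w) (G.map ψ) = 0 := by
      ext j
      have := congrArg ψ (congrFun hw j)
      simpa [Matrix.vecMul, dotProduct] using this
    have h2 : ψ ∘ w = 0 := by
      rw [← Matrix.vecMul_one (ψ ∘ w), ← hB, ← Matrix.vecMul_vecMul, h1, Matrix.zero_vecMul]
    ext l
    have := congrFun h2 l
    simpa using this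
  exact surj G (by simpa using hli.rank_matrix) w

theorem fsmooth {n m : ℕ} (D : MvPolynomial (Fin n) ℚ) (g : Fin m → MvPolynomial (Fin n) ℚ)
    (I : Ideal (Localization.Away D))
    (hI : I = Ideal.span (algebraMap (MvPolynomial (Fin n) ℚ) (Localization.Away D) '' Set.range g))
    (b : Matrix (Fin n) (Fin m) (Localization.Away D ⧸ I))
    (hb : (Matrix.of fun l j => algebraMap (MvPolynomial (Fin n) ℚ) (Localization.Away D ⧸ I)
      (pderiv j (g l))) * b = 1) :
    Algebra.FormallySmooth ℚ (Localization.Away D ⧸ I) := by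
  refine Algebra.FormallySmooth.of_comp_surjective ?_
  intro B _ _ J hJ φ
  have hgI : ∀ l, algebraMap (MvPolynomial (Fin n) ℚ) (Localization.Away D ⧸ I) (g l) = 0 := by
    intro l
    rw [IsScalarTower.algebraMap_apply _ (Localization.Away D), Ideal.Quotient.algebraMap_eq,
      Ideal.Quotient.eq_zero_iff_mem, hI]
    exact Ideal.subset_span ⟨_, ⟨l, rfl⟩, rfl⟩
  let π : MvPolynomial (Fin n) ℚ →ₐ[ℚ] (Localization.Away D ⧸ I) :=
    IsScalarTower.toAlgHom ℚ _ _
  choose x hx using fun j => Ideal.Quotient.mk_surjective (φ (π (X j)))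
  choose c hc using fun j l => Ideal.Quotient.mk_surjective (φ (b j l))
  have hmk : ∀ (y : Fin n → B), (∀ j, Ideal.Quotient.mk J (y j) = φ (π (X j))) → ∀ p,
      Ideal.Quotient.mk J (aeval y p) = φ (π p) := by
    intro y hy p
    have : (Ideal.Quotient.mkₐ ℚ J).comp (aeval y) = φ.comp π := by
      ext j; simpa using hy j
    exact DFunLike.congr_fun this p
  have hgJ : ∀ l, aeval x (g l) ∈ J := by
    intro l
    rw [← Ideal.Quotient.eq_zero_iff_mem, hmk x hx]
    have : π (g l) = 0 := hgI l
    rw [this, map_zero]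
  have h2 : ∀ a ∈ J, ∀ b ∈ J, a * b = 0 := by
    intro a ha b hb
    have : a * b ∈ J ^ 2 := by rw [pow_two]; exact Ideal.mul_mem_mul ha hb
    simpa [hJ] using this
  let e : Fin n → B := fun j => - ∑ l, c j l * aeval x (g l)
  have he : ∀ j, e j ∈ J := fun j =>
    J.neg_mem (J.sum_mem fun l _ => J.mul_mem_left _ (hgJ l))
  have hy : ∀ j, Ideal.Quotient.mk J ((x + e) j) = φ (π (X j)) := by
    intro j
    rw [Pi.add_apply, map_add, Ideal.Quotient.eq_zero_iff_mem.2 (he j), add_zero, hx]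
  have hg0 : ∀ l, aeval (x + e) (g l) = 0 := by
    intro l
    rw [taylor1 J hJ x e he]
    have h5 : ∀ l', ((∑ j, aeval x (pderiv j (g l)) * c j l') - (1 : Matrix _ _ B) l l') ∈ J := by
      intro l'
      rw [← Ideal.Quotient.eq_zero_iff_mem, map_sub, map_sum, sub_eq_zero]
      have := congrArg φ (congrFun (congrFun hb l) l')
      simp only [Matrix.mul_apply, Matrix.of_apply, map_sum, map_mul] at this
      simp only [map_mul, hmk x hx, hc]
      refine this.trans ?_
      by_cases hll : l = l'
      · subst hll; simp
      · simp [hll]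
    have h6 : ∑ l', ((∑ j, aeval x (pderiv j (g l)) * c j l') - (1 : Matrix _ _ B) l l')
        * aeval x (g l') = 0 :=
      Finset.sum_eq_zero fun l' _ => h2 _ (h5 l') _ (hgJ l')
    simp only [sub_mul, Finset.sum_sub_distrib, Matrix.one_apply, ite_mul, one_mul, zero_mul,
      Finset.sum_ite_eq, Finset.mem_univ, if_true, Finset.sum_mul] at h6
    rw [Finset.sum_comm] at h6
    simp only [e, mul_neg, Finset.sum_neg_distrib, Finset.mul_sum, ← mul_assoc]
    linear_combination -h6
  have hDu : IsUnit (aeval (x + e) D) := by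
    have hn : IsNilpotent J := ⟨2, by simpa using hJ⟩
    rw [← IsNilpotent.isUnit_quotient_mk_iff hn, hmk _ hy]
    have : IsUnit (π D) := by
      change IsUnit (algebraMap (MvPolynomial (Fin n) ℚ) (Localization.Away D ⧸ I) D)
      rw [IsScalarTower.algebraMap_apply _ (Localization.Away D)]
      exact (IsLocalization.Away.algebraMap_isUnit D).map _
    exact this.map φ
  let ψ : Localization.Away D →ₐ[ℚ] B := IsLocalization.liftAlgHom (M := Submonoid.powers D)
    (f := aeval (x + e)) (by
      rintro ⟨_, k, rfl⟩
      simpa using hDu.pow k)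
  have hψ : ∀ p : MvPolynomial (Fin n) ℚ, ψ (algebraMap _ _ p) = aeval (x + e) p := fun p => by
    simp only [ψ, IsLocalization.liftAlgHom_apply]
    exact IsLocalization.lift_eq _ _
  have hψI : ∀ a ∈ I, ψ a = 0 := by
    intro a ha
    have : I ≤ RingHom.ker ψ := by
      rw [hI, Ideal.span_le]
      rintro _ ⟨_, ⟨l, rfl⟩, rfl⟩
      simp [hψ, hg0]
    exact this ha
  refine ⟨Ideal.Quotient.liftₐ I ψ hψI, ?_⟩
  apply Ideal.Quotient.algHom_ext
  apply IsLocalization.algHom_ext (Submonoid.powers D)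
  ext j
  have := hy j
  rw [← aeval_X (R := ℚ) (x + e) j, ← hψ] at this
  exact this

theorem emb (K : Type) [Field K] [Algebra ℚ K] [Algebra.FiniteType ℚ K] :
    Nonempty (K →ₐ[ℚ] ℂ) := by
  have hfin : Module.Finite ℚ K := finite_of_finite_type_of_isJacobsonRing _ _
  exact ⟨IsAlgClosed.lift⟩

theorem statement8 (n i : ℕ) (hi : i < n)
    (f : MvPolynomial (Fin n) ℚ) (hnc : f.totalDegree ≠ 0) (hsf : Squarefree f)
    -- at every point with `f = ∂₁f = ⋯ = ∂ᵢf = 0` and `Δ ≠ 0`, the Jacobian of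
    -- `(f, ∂₁f, …, ∂ᵢf)` has maximal rank `i + 1`
    (hjac : ∀ x : Fin n → ℂ, aeval x f = 0 →
      (∀ k : Fin i, aeval x (pderiv (Fin.castLE hi.le k) f) = 0) →
      aeval x (∑ j : Fin n, (pderiv j f) ^ 2) ≠ 0 →
      (jacobianMat n i hi f x).rank = i + 1) :
    -- the ideal `(f, ∂₁f, …, ∂ᵢf)` in `ℚ[X₁,…,Xₙ]_Δ` is radical
    (Ideal.span
        (algebraMap (MvPolynomial (Fin n) ℚ)
            (Localization.Away (∑ j : Fin n, (pderiv j f) ^ 2)) ''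
          Set.range (Fin.cons (α := fun _ : Fin (i + 1) => MvPolynomial (Fin n) ℚ) f
            (fun k : Fin i => pderiv (Fin.castLE hi.le k) f)))).IsRadical := by
  set D : MvPolynomial (Fin n) ℚ := ∑ j : Fin n, (pderiv j f) ^ 2 with hD
  set g : Fin (i + 1) → MvPolynomial (Fin n) ℚ :=
    Fin.cons (α := fun _ : Fin (i + 1) => MvPolynomial (Fin n) ℚ) f
            (fun k : Fin i => pderiv (Fin.castLE hi.le k) f) with hg
  generalize hI : Ideal.span (algebraMap (MvPolynomial (Fin n) ℚ) (Localization.Away D) ''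
    Set.range g) = I
  have hgI : ∀ l, algebraMap (MvPolynomial (Fin n) ℚ) (Localization.Away D ⧸ I) (g l) = 0 := by
    intro l
    rw [IsScalarTower.algebraMap_apply _ (Localization.Away D), Ideal.Quotient.algebraMap_eq,
      Ideal.Quotient.eq_zero_iff_mem, ← hI]
    exact Ideal.subset_span ⟨_, ⟨l, rfl⟩, rfl⟩
  have hDu : IsUnit (algebraMap (MvPolynomial (Fin n) ℚ) (Localization.Away D ⧸ I) D) := by
    rw [IsScalarTower.algebraMap_apply _ (Localization.Away D)]
    exact (IsLocalization.Away.algebraMap_isUnit D).map _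
  have hft1 : Algebra.FiniteType (MvPolynomial (Fin n) ℚ) (Localization.Away D) :=
    IsLocalization.finiteType_of_monoid_fg (Submonoid.powers D) _
  have hft2 : Algebra.FiniteType ℚ (Localization.Away D) :=
    Algebra.FiniteType.trans (S := MvPolynomial (Fin n) ℚ) inferInstance inferInstance
  have hft : Algebra.FiniteType ℚ (Localization.Away D ⧸ I) := inferInstance
  obtain ⟨b, hb⟩ := surj_of_max (S := Localization.Away D ⧸ I)
    (Matrix.of fun l j => algebraMap (MvPolynomial (Fin n) ℚ) (Localization.Away D ⧸ I)
      (pderiv j (g l))) (by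
    intro M hM
    let : Field ((Localization.Away D ⧸ I) ⧸ M) := Ideal.Quotient.field M
    obtain ⟨ψ⟩ := emb ((Localization.Away D ⧸ I) ⧸ M)
    refine surj_desc ψ.toRingHom _ ?_
    let θ : (Localization.Away D ⧸ I) →ₐ[ℚ] ℂ := ψ.comp (Ideal.Quotient.mkₐ ℚ M)
    let x : Fin n → ℂ := fun j => θ (algebraMap (MvPolynomial (Fin n) ℚ) _ (X j))
    have hx : ∀ p, aeval x p = θ (algebraMap (MvPolynomial (Fin n) ℚ) _ p) := by
      intro p
      have : aeval x = θ.comp (IsScalarTower.toAlgHom ℚ (MvPolynomial (Fin n) ℚ) _) := by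
        ext j; simp [x]
      exact DFunLike.congr_fun this p
    have h0 : ∀ l, aeval x (g l) = 0 := fun l => by rw [hx, hgI, map_zero]
    have key := hjac x (h0 0) (fun k => by simpa [hg] using h0 k.succ)
      (by rw [hx]; exact (hDu.map θ).ne_zero)
    convert key using 2
    ext l j
    simp only [jacobianMat, Matrix.map_apply, Matrix.of_apply]
    rw [hx]
    rfl)
  have hfs := fsmooth D g I hI.symm b hb
  have hfp : Algebra.FinitePresentation ℚ (Localization.Away D ⧸ I) :=
    Algebra.FinitePresentation.of_finiteType.1 hft
  have hs : Algebra.Smooth ℚ (Localization.Away D ⧸ I) := ⟨hfs, hfp⟩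
  have := smooth_red (Localization.Away D ⧸ I)
  exact (Ideal.isRadical_iff_quotient_reduced I).2 this
end

section
/- Let f ∈ ℚ[X₁,…,Xₙ] be a non-constant square-free polynomial of degree d ≥ 2 whose real zero set V = {x ∈ ℝⁿ : f(x) = 0} is non-empty and bounded and on which the gradient of f never vanishes (so V is a compact smooth hypersurface in ℝⁿ with regular equation f = 0). Then there exist a nonzero univariate polynomial q ∈ ℚ[U] and univariate polynomials p₁, …, pₙ ∈ ℚ[U] with deg pₖ < deg q for all k, such that for every connected component C of V there exists τ ∈ ℝ with q(τ) = 0 and (p₁(τ), …, pₙ(τ)) ∈ C. -/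
open MvPolynomial

theorem hfd {n : ℕ} (f : MvPolynomial (Fin n) ℚ) (x : Fin n → ℝ) :
    HasStrictFDerivAt (fun y : Fin n → ℝ => aeval y f)
      (∑ i, aeval x (pderiv i f) • (ContinuousLinearMap.proj i : (Fin n → ℝ) →L[ℝ] ℝ)) x := by
  induction f using MvPolynomial.induction_on with
  | C a => simpa using hasStrictFDerivAt_const _ _
  | add p q hp hq =>
    simp only [map_add, add_smul, Finset.sum_add_distrib]
    exact hp.add hq
  | mul_X p i hp =>
    have h1 : HasStrictFDerivAt (fun y : Fin n → ℝ => y i)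
        (ContinuousLinearMap.proj i : (Fin n → ℝ) →L[ℝ] ℝ) x :=
      (ContinuousLinearMap.proj (R := ℝ) (φ := fun _ : Fin n => ℝ) i).hasStrictFDerivAt
    have := hp.mul h1
    simp only [map_mul, aeval_X]
    refine this.congr_fderiv ?_
    ext v
    simp [pderiv_mul, pderiv_X, Pi.single_apply, add_mul, Finset.sum_add_distrib, Finset.mul_sum,
      apply_ite]
    apply Finset.sum_congr rfl
    intros; ring

def Good {n : ℕ} (y : Fin n → ℝ) : Prop :=
  ∃ (q : Polynomial ℚ) (r : Fin n → Polynomial ℚ) (τ : ℝ), q ≠ 0 ∧ Polynomial.aeval τ q = 0 ∧ ∀ k, Polynomial.aeval τ (r k) = y k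

theorem combine {n : ℕ} (S : Finset (Fin n → ℝ)) (hS : ∀ y ∈ S, Good y) :
   ∃ (q : Polynomial ℚ) (p : Fin n → Polynomial ℚ),
      q ≠ 0 ∧ (∀ k : Fin n, (p k).degree < q.degree) ∧
      ∀ y ∈ S, ∃ τ : ℝ, Polynomial.aeval τ q = 0 ∧ (fun k : Fin n => Polynomial.aeval τ (p k)) = y := by
  classical
  induction S using Finset.induction_on with
  | empty => exact ⟨1, 0, one_ne_zero, by simp, by simp⟩
  | insert a S ha ih =>
    obtain ⟨q, p, hq, -, hp⟩ := ih (fun y hy => hS y (Finset.mem_insert_of_mem hy))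
    obtain ⟨q', r, τ, hq', hτ, hr⟩ := hS a (Finset.mem_insert_self _ _)
    obtain ⟨c, hc⟩ : ∃ c : ℕ, Polynomial.aeval (τ + c) q ≠ 0 := by
      by_contra! h
      have hinf : (Set.range (fun c : ℕ => τ + (c:ℝ))).Infinite :=
        Set.infinite_range_of_injective (fun a b hab => by simpa using hab)
      apply hinf
      refine (Polynomial.rootSet_finite q ℝ).subset ?_
      rintro _ ⟨c, rfl⟩
      rw [Polynomial.mem_rootSet]
      exact ⟨hq, h c⟩
    have hint : IsIntegral ℚ (τ + c) := by
      have : IsAlgebraic ℚ τ := ⟨q', hq', hτ⟩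
      exact this.isIntegral.add (isIntegral_algebraMap (x := (c:ℚ)) |> fun h => by simpa using h)
    set m := minpoly ℚ (τ + c)
    have hm : Irreducible m := minpoly.irreducible hint
    have hco : IsCoprime m q := by
      rw [hm.coprime_iff_not_dvd]
      intro hd
      exact hc (by
        obtain ⟨s, hs⟩ := hd
        rw [hs, map_mul, minpoly.aeval, zero_mul])
    obtain ⟨u, v, huv⟩ := hco
    have hmq : m * q ≠ 0 := mul_ne_zero hm.ne_zero hq
    have key : ∀ (g : Polynomial ℚ) (t : ℝ), Polynomial.aeval t (m * q) = 0 →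
        Polynomial.aeval t (g % (m * q)) = Polynomial.aeval t g := by
      intro g t ht
      conv_rhs => rw [← EuclideanDomain.mod_add_div g (m * q)]
      rw [map_add, map_mul _ (m * q), ht, zero_mul, add_zero]
    refine ⟨m * q, fun k => (p k * (u * m) + ((r k).comp (Polynomial.X - Polynomial.C (c:ℚ))) * (v * q)) % (m * q), hmq, fun k => Polynomial.degree_mod_lt _ hmq, ?_⟩
    intro y hy
    rcases Finset.mem_insert.1 hy with rfl | hy
    · have h0 : Polynomial.aeval (τ + c) m = 0 := minpoly.aeval _ _
      have h1 : Polynomial.aeval (τ + c) (m * q) = 0 := by rw [map_mul, h0, zero_mul]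
      refine ⟨τ + c, h1, ?_⟩
      have h2 : Polynomial.aeval (τ + c) v * Polynomial.aeval (τ + c) q = 1 := by
        have := congrArg (Polynomial.aeval (τ + (c:ℝ))) huv
        simpa [h0] using this
      funext k
      rw [key _ _ h1]
      simp [h0, h2, Polynomial.aeval_comp, hr]
    · obtain ⟨t, ht, hty⟩ := hp y hy
      have h1 : Polynomial.aeval t (m * q) = 0 := by rw [map_mul, ht, mul_zero]
      refine ⟨t, h1, ?_⟩
      have h2 : Polynomial.aeval t u * Polynomial.aeval t m = 1 := by
        have := congrArg (Polynomial.aeval t) huv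
        simpa [ht] using this
      rw [← hty]
      funext k
      rw [key _ _ h1]
      simp [ht, h2]

theorem local_good {n : ℕ} (f : MvPolynomial (Fin n) ℚ) (x : Fin n → ℝ) (hx : aeval x f = 0)
    (j : Fin n) (hj : aeval x (pderiv j f) ≠ 0) :
    ∃ U ∈ nhds x, ∃ a : Fin n → ℝ, Good a ∧ ∀ y ∈ U, aeval y f = 0 →
      a ∈ connectedComponentIn {y : Fin n → ℝ | aeval y f = 0} y := by
  classical
  set L : (Fin n → ℝ) →L[ℝ] ℝ :=
    ∑ i, aeval x (pderiv i f) • (ContinuousLinearMap.proj i : (Fin n → ℝ) →L[ℝ] ℝ) with hL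
  set F : (Fin n → ℝ) → (Fin n → ℝ) := fun y i => if i = j then aeval y f else y i with hF
  set F' : (Fin n → ℝ) →L[ℝ] (Fin n → ℝ) := ContinuousLinearMap.pi
    (fun i => if i = j then L else ContinuousLinearMap.proj i) with hF'
  have hd : HasStrictFDerivAt F F' x := by
    rw [hF', hasStrictFDerivAt_pi]
    intro i
    by_cases h : i = j
    · simp only [hF, h, if_true]
      exact hfd f x
    · simp only [hF, h, if_false]
      exact (ContinuousLinearMap.proj (R := ℝ) (φ := fun _ : Fin n => ℝ) i).hasStrictFDerivAt
  have hinj : Function.Injective (F' : (Fin n → ℝ) →ₗ[ℝ] (Fin n → ℝ)) := by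
    rw [← LinearMap.ker_eq_bot, LinearMap.ker_eq_bot']
    intro v hv
    have h1 : ∀ i, i ≠ j → v i = 0 := by
      intro i hi
      have := congrFun hv i
      simpa [hF', hi] using this
    have h2 : L v = 0 := by
      have := congrFun hv j
      simpa [hF'] using this
    have h3 : L v = aeval x (pderiv j f) * v j := by
      rw [hL]
      simp only [ContinuousLinearMap.sum_apply, ContinuousLinearMap.smul_apply,
        ContinuousLinearMap.proj_apply, smul_eq_mul]
      rw [Finset.sum_eq_single j]
      · intro i _ hi
        rw [h1 i hi, mul_zero]
      · simp
    funext i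
    by_cases h : i = j
    · subst h
      rw [h3] at h2
      simpa [hj] using h2
    · exact h1 i h
  let E : (Fin n → ℝ) ≃L[ℝ] (Fin n → ℝ) :=
    (LinearEquiv.ofInjectiveEndo (F' : (Fin n → ℝ) →ₗ[ℝ] (Fin n → ℝ)) hinj).toContinuousLinearEquiv
  have hE : HasStrictFDerivAt F (E : (Fin n → ℝ) →L[ℝ] (Fin n → ℝ)) x := by
    refine hd.congr_fderiv ?_
    ext v
    rfl
  set e := hE.toOpenPartialHomeomorph F with he
  have hecoe : ∀ y, e y = F y := fun y => rfl
  have hxs : x ∈ e.source := hE.mem_toOpenPartialHomeomorph_source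
  have hxt : e x ∈ e.target := e.map_source hxs
  obtain ⟨ε, hε, hball⟩ := Metric.isOpen_iff.1 e.open_target _ hxt
  -- the connected slice
  set W : Set (Fin n → ℝ) := Metric.ball (e x) ε ∩ {z | z j = 0} with hW
  have hWconv : Convex ℝ W := by
    apply (convex_ball _ _).inter
    intro a ha b hb s t _ _ _
    simp only [Set.mem_setOf_eq] at *
    simp [ha, hb]
  have hWt : W ⊆ e.target := fun z hz => hball hz.1
  have hsymm : ∀ z ∈ W, aeval (e.symm z) f = 0 ∧ ∀ i, i ≠ j → e.symm z i = z i := by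
    intro z hz
    have h := e.right_inv (hWt hz)
    rw [hecoe] at h
    constructor
    · have := congrFun h j
      simp only [hF, if_true] at this
      rw [this]; exact hz.2
    · intro i hi
      have := congrFun h i
      simpa only [hF, hi, if_false] using this
  have hconn : IsPreconnected (e.symm '' W) :=
    hWconv.isPreconnected.image _ (e.continuousOn_symm.mono hWt)
  have hsub : e.symm '' W ⊆ {y : Fin n → ℝ | aeval y f = 0} := by
    rintro _ ⟨z, hz, rfl⟩
    exact (hsymm z hz).1
  -- rational point
  obtain ⟨w, hw⟩ : ∃ w : Fin n → ℚ, (Pi.map (fun _ => ((↑) : ℚ → ℝ)) w) ∈ Metric.ball (e x) ε :=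
    (DenseRange.piMap (fun _ => Rat.isDenseEmbedding_coe_real.dense)).exists_mem_open
      Metric.isOpen_ball ⟨_, Metric.mem_ball_self hε⟩
  set z : Fin n → ℝ := fun i => if i = j then 0 else (w i : ℝ) with hz
  have hzW : z ∈ W := by
    refine ⟨?_, by simp [hz]⟩
    rw [Metric.mem_ball, dist_pi_lt_iff hε] at hw ⊢
    intro i
    by_cases h : i = j
    · simp only [hz, h, if_true]
      have : e x j = 0 := by rw [hecoe]; simp [hF, hx]
      rw [this]; simpa using hε
    · simpa [hz, h] using hw i
  set a := e.symm z with ha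
  have has : a ∈ e.source := e.map_target (hWt hzW)
  obtain ⟨ha0, hai⟩ := hsymm z hzW
  refine ⟨e.source ∩ e ⁻¹' Metric.ball (e x) ε,
    (e.isOpen_inter_preimage Metric.isOpen_ball).mem_nhds ⟨hxs, Metric.mem_ball_self hε⟩,
    a, ?_, ?_⟩
  · set g : Polynomial ℚ := aeval (fun i => if i = j then Polynomial.X else Polynomial.C (w i)) f
      with hg
    have hgt : ∀ t : ℝ, Polynomial.aeval t g = aeval (Function.update a j t) f := by
      intro t
      rw [hg, ← AlgHom.comp_apply, comp_aeval]
      congr 2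
      funext i
      by_cases h : i = j
      · subst h; simp
      · simp only [h, if_false]
        rw [Function.update_of_ne h, ha, hai i h]
        simp [hz, h]
    refine ⟨g, fun i => if i = j then Polynomial.X else Polynomial.C (w i), a j, ?_, ?_, ?_⟩
    · intro h0
      have hc : Continuous (fun t : ℝ => Function.update a j t) := continuous_const.update j continuous_id
      have hev : ∀ᶠ t in nhds (a j), Function.update a j t ∈ e.source := by
        apply hc.continuousAt.eventually_mem
        rw [Function.update_eq_self]
        exact e.open_source.mem_nhds has
      have hev2 : ∀ᶠ t in nhdsWithin (a j) {a j}ᶜ, Function.update a j t ∈ e.source :=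
        hev.filter_mono nhdsWithin_le_nhds
      obtain ⟨t, ht, hta⟩ := (hev2.and self_mem_nhdsWithin).exists
      apply hta
      have : Function.update a j t = a := by
        apply e.injOn ht has
        rw [hecoe, hecoe]
        funext i
        by_cases h : i = j
        · simp only [hF, h, if_true]
          rw [← hgt, h0, map_zero, ha, ha0]
        · simp [hF, h]
      have := congrFun this j
      simpa using this
    · rw [hgt, Function.update_eq_self, ha, ha0]
    · intro i
      by_cases h : i = j
      · simp [h]
      · rw [ha, hai i h]; simp [hz, h]
  · rintro y ⟨hys, hyb⟩ hy
    have hyW : e y ∈ W := ⟨hyb, by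
      change F y j = 0
      simp [hF, hy]⟩
    exact hconn.subset_connectedComponentIn ⟨e y, hyW, e.left_inv hys⟩ hsub ⟨z, hzW, rfl⟩

theorem statement11 (n : ℕ) (f : MvPolynomial (Fin n) ℚ)
    -- `f` is square-free of degree `d ≥ 2` (in particular non-constant)
    (hdeg : 2 ≤ f.totalDegree) (hsf : Squarefree f)
    -- `V = {x ∈ ℝⁿ : f(x) = 0}` is non-empty and bounded
    (hVne : {x : Fin n → ℝ | aeval x f = 0}.Nonempty)
    (hbdd : Bornology.IsBounded {x : Fin n → ℝ | aeval x f = 0})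
    -- the gradient of `f` never vanishes on `V`
    (hgrad : ∀ x : Fin n → ℝ, aeval x f = 0 → ∃ j : Fin n, aeval x (pderiv j f) ≠ 0) :
    ∃ (q : Polynomial ℚ) (p : Fin n → Polynomial ℚ),
      q ≠ 0 ∧ (∀ k : Fin n, (p k).degree < q.degree) ∧
      -- every connected component of `V` (namely, the component of any `x ∈ V`)
      -- contains a point `(p₁(τ), …, pₙ(τ))` with `τ` a real root of `q`
      ∀ x : Fin n → ℝ, aeval x f = 0 →
        ∃ τ : ℝ, Polynomial.aeval τ q = 0 ∧
          (fun k : Fin n => Polynomial.aeval τ (p k)) ∈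
            connectedComponentIn {y : Fin n → ℝ | aeval y f = 0} x := by
  have hcont : Continuous (fun y : Fin n → ℝ => aeval y f) :=
    continuous_iff_continuousAt.2 fun x => (hfd f x).continuousAt
  have hcomp : IsCompact {x : Fin n → ℝ | aeval x f = 0} :=
    Metric.isCompact_of_isClosed_isBounded (isClosed_singleton.preimage hcont) hbdd
  have hfin : ∃ S : Finset (Fin n → ℝ), (∀ y ∈ S, Good y) ∧
      ∀ y ∈ {x : Fin n → ℝ | aeval x f = 0}, aeval y f = 0 →
        ∃ a ∈ S, a ∈ connectedComponentIn {y : Fin n → ℝ | aeval y f = 0} y := by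
    classical
    refine hcomp.induction_on (p := fun s => ∃ S : Finset (Fin n → ℝ), (∀ y ∈ S, Good y) ∧
      ∀ y ∈ s, aeval y f = 0 →
        ∃ a ∈ S, a ∈ connectedComponentIn {y : Fin n → ℝ | aeval y f = 0} y) ?_ ?_ ?_ ?_
    · exact ⟨∅, by simp, by simp⟩
    · rintro s t hst ⟨S, h1, h2⟩
      exact ⟨S, h1, fun y hy => h2 y (hst hy)⟩
    · rintro s t ⟨S, h1, h2⟩ ⟨T, h3, h4⟩
      refine ⟨S ∪ T, ?_, ?_⟩
      · intro y hy
        rcases Finset.mem_union.1 hy with h | h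
        exacts [h1 y h, h3 y h]
      · rintro y (hy | hy) h0
        · obtain ⟨a, h, h'⟩ := h2 y hy h0
          exact ⟨a, Finset.mem_union_left _ h, h'⟩
        · obtain ⟨a, h, h'⟩ := h4 y hy h0
          exact ⟨a, Finset.mem_union_right _ h, h'⟩
    · intro x hx
      obtain ⟨j, hj⟩ := hgrad x hx
      obtain ⟨U, hU, a, ha, h⟩ := local_good f x hx j hj
      exact ⟨U, mem_nhdsWithin_of_mem_nhds hU, {a}, by simpa using ha,
        fun y hy h0 => ⟨a, by simp, h y hy h0⟩⟩
  obtain ⟨S, hS, hS'⟩ := hfin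
  obtain ⟨q, p, hq, hdeg', hp⟩ := combine S hS
  refine ⟨q, p, hq, hdeg', fun x hx => ?_⟩
  obtain ⟨a, haS, ha⟩ := hS' x hx hx
  obtain ⟨τ, hτ, h⟩ := hp a haS
  exact ⟨τ, hτ, h ▸ ha⟩
end

section
/- Let f ∈ ℚ[X₁,…,Xₙ] be a non-constant square-free polynomial whose real zero set V = {x ∈ ℝⁿ : f(x) = 0} is non-empty and bounded and on which the gradient of f never vanishes. Then every connected component of V contains a point all of whose coordinates are real algebraic numbers (i.e., real numbers algebraic over ℚ). -/
open MvPolynomial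

theorem strictF {n : ℕ} (f : MvPolynomial (Fin n) ℚ) (x : Fin n → ℝ) :
    HasStrictFDerivAt (fun z : Fin n → ℝ => aeval z f)
      (∑ k, (aeval x (pderiv k f)) • (ContinuousLinearMap.proj k : (Fin n → ℝ) →L[ℝ] ℝ)) x := by
  induction f using MvPolynomial.induction_on with
  | C a =>
    simp only [aeval_C, pderiv_C, map_zero, zero_smul, Finset.sum_const_zero]
    exact hasStrictFDerivAt_const _ _
  | add p q hp hq =>
    simp only [map_add, add_smul, Finset.sum_add_distrib]
    exact hp.add hq
  | mul_X p i hp =>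
    simp only [map_mul, aeval_X]
    have h := hp.mul (ContinuousLinearMap.hasStrictFDerivAt
      (ContinuousLinearMap.proj i : (Fin n → ℝ) →L[ℝ] ℝ) (x := x))
    refine h.congr_fderiv ?_
    ext v
    simp [pderiv_X, Derivation.leibniz, Pi.single_apply, add_mul, Finset.sum_add_distrib,
      Finset.mul_sum, apply_ite]
    exact Finset.sum_congr rfl fun k _ => by ring

theorem statement12 (n : ℕ) (f : MvPolynomial (Fin n) ℚ)
    (hnc : f.totalDegree ≠ 0) (hsf : Squarefree f)
    -- `V = {x ∈ ℝⁿ : f(x) = 0}` is non-empty and bounded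
    (hVne : {x : Fin n → ℝ | aeval x f = 0}.Nonempty)
    (hbdd : Bornology.IsBounded {x : Fin n → ℝ | aeval x f = 0})
    -- the gradient of `f` never vanishes on `V`
    (hgrad : ∀ x : Fin n → ℝ, aeval x f = 0 → ∃ j : Fin n, aeval x (pderiv j f) ≠ 0) :
    -- every connected component of `V` contains a point with real algebraic coordinates
    ∀ x : Fin n → ℝ, aeval x f = 0 →
      ∃ y ∈ connectedComponentIn {z : Fin n → ℝ | aeval z f = 0} x,
        ∀ k : Fin n, IsAlgebraic ℚ (y k) := by
  intro x hx
  obtain ⟨j, hj⟩ := hgrad x hx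
  set L : (Fin n → ℝ) →L[ℝ] ℝ :=
    ∑ k, (aeval x (pderiv k f)) • (ContinuousLinearMap.proj k : (Fin n → ℝ) →L[ℝ] ℝ) with hL
  let A : (Fin n → ℝ) →L[ℝ] (Fin n → ℝ) :=
    ContinuousLinearMap.pi fun k => if k = j then L else ContinuousLinearMap.proj k
  let Φ : (Fin n → ℝ) → (Fin n → ℝ) := fun z k => if k = j then aeval z f else z k
  have hA : Function.Injective A.toLinearMap := by
    rw [injective_iff_map_eq_zero]
    intro v hv
    have h1 : ∀ k, k ≠ j → v k = 0 := fun k hk => by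
      have := congrFun hv k
      simpa [A, hk] using this
    have h2 : L v = 0 := by
      have := congrFun hv j
      simpa [A] using this
    have h3 : L v = aeval x (pderiv j f) * v j := by
      rw [hL]
      simp only [ContinuousLinearMap.sum_apply, ContinuousLinearMap.smul_apply,
        ContinuousLinearMap.proj_apply, smul_eq_mul]
      exact Finset.sum_eq_single j (fun k _ hk => by rw [h1 k hk, mul_zero]) (by simp)
    ext k
    by_cases hk : k = j
    · subst hk
      rw [h3] at h2
      simpa [hj] using h2
    · exact h1 k hk
  let E : (Fin n → ℝ) ≃L[ℝ] (Fin n → ℝ) :=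
    (LinearEquiv.ofInjectiveEndo A.toLinearMap hA).toContinuousLinearEquiv
  have hEA : (E : (Fin n → ℝ) →L[ℝ] (Fin n → ℝ)) = A := by
    ext v k; rfl
  have hΦ : HasStrictFDerivAt Φ (E : (Fin n → ℝ) →L[ℝ] (Fin n → ℝ)) x := by
    rw [hEA]
    refine hasStrictFDerivAt_pi.2 fun k => ?_
    by_cases hk : k = j
    · simp only [hk, if_true]
      exact strictF f x
    · simp only [hk, if_false]
      exact ContinuousLinearMap.hasStrictFDerivAt
        (ContinuousLinearMap.proj k : (Fin n → ℝ) →L[ℝ] ℝ)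
  let e := hΦ.toOpenPartialHomeomorph Φ
  have he : ∀ z, e z = Φ z := fun z => rfl
  have hxs : x ∈ e.source := hΦ.mem_toOpenPartialHomeomorph_source
  have hxt : Φ x ∈ e.target := hΦ.image_mem_toOpenPartialHomeomorph_target
  obtain ⟨ε, hε, hball⟩ := Metric.isOpen_iff.1 e.open_target _ hxt
  have hxj : Φ x j = 0 := by simp [Φ, hx]
  let S : Set (Fin n → ℝ) := Metric.ball (Φ x) ε ∩ {w | w j = 0}
  have hSc : IsPreconnected S := by
    refine Convex.isPreconnected ?_
    refine (convex_ball _ _).inter ?_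
    intro a ha b hb s t _ _ _
    simp only [Set.mem_setOf_eq] at ha hb ⊢
    simp [ha, hb]
  have hSt : S ⊆ e.target := fun w hw => hball hw.1
  have hTc : IsPreconnected (e.symm '' S) :=
    hSc.image _ (e.continuousOn_symm.mono hSt)
  have hval : ∀ w ∈ S, Φ (e.symm w) = w := fun w hw => e.right_inv (hSt hw)
  have hTV : e.symm '' S ⊆ {z : Fin n → ℝ | aeval z f = 0} := by
    rintro _ ⟨w, hw, rfl⟩
    have h1 := congrFun (hval w hw) j
    have h2 : w j = 0 := hw.2
    simp only [Φ, if_true] at h1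
    rw [h2] at h1
    exact h1
  have hxT : x ∈ e.symm '' S :=
    ⟨Φ x, ⟨Metric.mem_ball_self hε, hxj⟩, e.left_inv hxs⟩
  have hq : ∀ k, ∃ q : ℚ, dist (q : ℝ) (Φ x k) < ε / 2 := fun k => by
    obtain ⟨q, hq⟩ := Rat.denseRange_cast.exists_dist_lt (Φ x k) (half_pos hε)
    exact ⟨q, by rwa [dist_comm]⟩
  choose q hq using hq
  let w : Fin n → ℝ := fun k => if k = j then 0 else (q k : ℝ)
  have hwS : w ∈ S := by
    refine ⟨?_, by simp [w]⟩
    rw [Metric.mem_ball]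
    refine lt_of_le_of_lt ((dist_pi_le_iff (half_pos hε).le).2 fun k => ?_) (half_lt_self hε)
    by_cases hk : k = j
    · subst hk
      simp only [w, hxj, if_true, dist_self]
      exact (half_pos hε).le
    · simpa [w, hk] using (hq k).le
  set y := e.symm w with hy
  have hys : y ∈ e.source := e.map_target (hSt hwS)
  have hyV : aeval y f = 0 := hTV ⟨w, hwS, rfl⟩
  have hyk : ∀ k, k ≠ j → y k = q k := fun k hk => by
    have := congrFun (hval w hwS) k
    simpa [Φ, w, hk] using this
  refine ⟨y, hTc.subset_connectedComponentIn hxT hTV ⟨w, hwS, rfl⟩, fun k => ?_⟩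
  by_cases hk : k = j
  swap
  · rw [hyk k hk]
    exact isAlgebraic_algebraMap (q k)
  subst hk
  let p : Polynomial ℚ :=
    aeval (fun i => if i = k then Polynomial.X else Polynomial.C (q i)) f
  have hp : ∀ t : ℝ, Polynomial.aeval t p = aeval (Function.update y k t) f := fun t => by
    change (Polynomial.aeval t) (aeval _ f) = _
    rw [← AlgHom.comp_apply, comp_aeval]
    congr 2
    funext i
    by_cases hi : i = k
    · subst hi; simp
    · simp [hi, hyk i hi]
  refine ⟨p, fun hp0 => ?_, by rw [hp, Function.update_eq_self, hyV]⟩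
  have hcont : Continuous fun t : ℝ => Function.update y k t :=
    continuous_const.update k continuous_id
  have hnh : ∀ᶠ t in nhds (y k), Function.update y k t ∈ e.source := by
    refine hcont.continuousAt.eventually_mem (e.open_source.mem_nhds ?_)
    rwa [Function.update_eq_self]
  have heq : ∀ᶠ t in nhds (y k), t = y k := by
    filter_upwards [hnh] with t ht
    have h0 : e (Function.update y k t) = e y := by
      rw [he, he]
      funext i
      by_cases hi : i = k
      · simp only [Φ, hi, if_true]
        rw [← hp, hp0, map_zero, hyV]
      · simp [Φ, hi]
    have := congrFun (e.injOn ht hys h0) k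
    simpa using this
  have h1 : ∀ᶠ t in nhdsWithin (y k) {y k}ᶜ, t = y k := heq.filter_mono nhdsWithin_le_nhds
  obtain ⟨t, ht, ht'⟩ := (h1.and self_mem_nhdsWithin).exists
  exact ht' ht
end
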